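/- There exist a C^∞ function f : ℝ² → ℝ and a radius r > 0 such that: (i) f(x,y) = (γ/2)x² + xy − (γ/2)y² for every (x,y) in the open Euclidean ball B_r centered at the origin; (ii) the gradient of f is orthogonal to v at every point, i.e. ∂_x f(z)·v₁(z) + ∂_y f(z)·v₂(z) = 0 for all z ∈ ℝ²; (iii) the origin is the unique critical point of f, i.e. ∇f(z) ≠ 0 for every z ≠ (0,0); and (iv) for every R < ∞ there exists C < ∞ such that for every (x,y) ∈ [−R,R]²: f(x,y) − inf_{x'∈[−R,R]} f(x',y) ≤ C|∂_x f(x,y)|² and sup_{y'∈[−R,R]} f(x,y') − f(x,y) ≤ C|∂_y f(x,y)|². -/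

import Mathlib

open Set Filter

/-- The vector field `v(x,y) = ((γy - x) φ(x² + axy + by²), (y + γx) φ(y² - axy + bx²))`,
with `a = γ + 1` and `b = γ² + γ + 1`. -/
def vf (γ : ℝ) (φ : ℝ → ℝ) (p : ℝ × ℝ) : ℝ × ℝ :=
  ((γ * p.2 - p.1) * φ (p.1 ^ 2 + (γ + 1) * p.1 * p.2 + (γ ^ 2 + γ + 1) * p.2 ^ 2),
   (p.2 + γ * p.1) * φ (p.2 ^ 2 - (γ + 1) * p.1 * p.2 + (γ ^ 2 + γ + 1) * p.1 ^ 2))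

/-- Partial derivative in the first variable. -/
noncomputable def pdx (f : ℝ × ℝ → ℝ) (p : ℝ × ℝ) : ℝ :=
  deriv (fun x => f (x, p.2)) p.1

/-- Partial derivative in the second variable. -/
noncomputable def pdy (f : ℝ × ℝ → ℝ) (p : ℝ × ℝ) : ℝ :=
  deriv (fun y => f (p.1, y)) p.2


open Topology

/-- Joint differentiability from continuous partial derivatives. -/
lemma aux_hasFDerivAt {H a b : ℝ × ℝ → ℝ} (ha : Continuous a) (hb : Continuous b)
    (h1 : ∀ p : ℝ × ℝ, HasDerivAt (fun t => H (t, p.2)) (a p) p.1)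
    (h2 : ∀ p : ℝ × ℝ, HasDerivAt (fun c => H (p.1, c)) (b p) p.2) (p : ℝ × ℝ) :
    HasFDerivAt H (a p • ContinuousLinearMap.fst ℝ ℝ ℝ + b p • ContinuousLinearMap.snd ℝ ℝ ℝ) p := by
  have key := hasStrictFDerivAt_uncurry_coprod (𝕜 := ℝ) (u := p) (f := fun t c => H (t, c))
    (f₁ := fun t c => ContinuousLinearMap.toSpanSingleton ℝ (a (t, c)))
    (f₂ := fun t c => ContinuousLinearMap.toSpanSingleton ℝ (b (t, c)))
    (Eventually.of_forall fun v => (h1 v).hasFDerivAt)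
    (Eventually.of_forall fun v => (h2 v).hasFDerivAt)
    (by
      have : Continuous fun q : ℝ × ℝ => ContinuousLinearMap.toSpanSingleton ℝ (a q) :=
        (ContinuousLinearMap.toSpanSingletonCLE (𝕜 := ℝ) (E := ℝ)).continuous.comp ha
      exact this.continuousAt)
    (by
      have : Continuous fun q : ℝ × ℝ => ContinuousLinearMap.toSpanSingleton ℝ (b q) :=
        (ContinuousLinearMap.toSpanSingletonCLE (𝕜 := ℝ) (E := ℝ)).continuous.comp hb
      exact this.continuousAt)
  have k2 := key.hasFDerivAt
  refine k2.congr_fderiv ?_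
  ext <;> simp [Function.HasUncurry.uncurry]

lemma aux_contDiff_succ {H a b : ℝ × ℝ → ℝ} {n : ℕ} (ha : ContDiff ℝ n a) (hb : ContDiff ℝ n b)
    (h1 : ∀ p : ℝ × ℝ, HasDerivAt (fun t => H (t, p.2)) (a p) p.1)
    (h2 : ∀ p : ℝ × ℝ, HasDerivAt (fun c => H (p.1, c)) (b p) p.2) :
    ContDiff ℝ (n + 1) H := by
  rw [contDiff_succ_iff_hasFDerivAt]
  refine ⟨_, ?_, aux_hasFDerivAt ha.continuous hb.continuous h1 h2⟩
  exact (ha.smul contDiff_const).add (hb.smul contDiff_const)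

/-- Derivative of the parametric integral in the parameter. -/
lemma aux_param_deriv {h hc : ℝ × ℝ → ℝ} (hh : Continuous h) (hhc : Continuous hc)
    (hd : ∀ p : ℝ × ℝ, HasDerivAt (fun c => h (p.1, c)) (hc p) p.2) (s c : ℝ) :
    HasDerivAt (fun c => ∫ σ in (0:ℝ)..s, h (σ, c)) (∫ σ in (0:ℝ)..s, hc (σ, c)) c := by
  have hcomp : IsCompact (uIcc (0:ℝ) s ×ˢ Metric.closedBall c 1) :=
    isCompact_uIcc.prod (isCompact_closedBall c 1)
  obtain ⟨M, hM⟩ := hcomp.exists_bound_of_continuousOn hhc.continuousOn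
  refine (intervalIntegral.hasDerivAt_integral_of_dominated_loc_of_deriv_le
    (F := fun c σ => h (σ, c)) (F' := fun c σ => hc (σ, c)) (bound := fun _ => M)
    (Metric.closedBall_mem_nhds c one_pos) ?_ ?_ ?_ ?_ ?_ ?_).2
  · exact Eventually.of_forall fun x => (by fun_prop : Continuous fun σ => h (σ, x)).aestronglyMeasurable
  · exact (by fun_prop : Continuous fun σ => h (σ, c)).intervalIntegrable _ _
  · exact (by fun_prop : Continuous fun σ => hc (σ, c)).aestronglyMeasurable
  · exact Eventually.of_forall fun t ht x hx => hM (t, x) ⟨uIoc_subset_uIcc ht, hx⟩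
  · exact intervalIntegrable_const
  · exact Eventually.of_forall fun t ht x hx => hd (t, x)

lemma aux_param_contDiff (n : ℕ) : ∀ {h : ℝ × ℝ → ℝ}, ContDiff ℝ n h →
    ContDiff ℝ n (fun p : ℝ × ℝ => ∫ σ in (0:ℝ)..p.1, h (σ, p.2)) := by
  induction n with
  | zero =>
    intro h hh
    have hh' := hh.continuous
    simp only [Nat.cast_zero, contDiff_zero]
    exact intervalIntegral.continuous_parametric_intervalIntegral_of_continuous
      (f := fun (p : ℝ × ℝ) σ => h (σ, p.2)) (by fun_prop) continuous_fst
  | succ n ih =>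
    intro h hh
    have hh' := hh.continuous
    have hdiff : Differentiable ℝ h := hh.differentiable (by simp)
    have hc : ContDiff ℝ n (fun p : ℝ × ℝ => fderiv ℝ h p (0, 1)) := by
      have : ContDiff ℝ n (fderiv ℝ h) := hh.fderiv_right (by simp)
      exact this.clm_apply contDiff_const
    have hd : ∀ p : ℝ × ℝ, HasDerivAt (fun c => h (p.1, c)) (fderiv ℝ h p (0, 1)) p.2 := by
      intro p
      have h1 := (hdiff p).hasFDerivAt
      have h2 : HasDerivAt (fun c : ℝ => (p.1, c)) ((0:ℝ), (1:ℝ)) p.2 :=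
        (hasDerivAt_const _ _).prodMk (hasDerivAt_id _)
      exact h1.comp_hasDerivAt p.2 h2
    push_cast
    refine aux_contDiff_succ (a := h) (hh.of_le (by norm_cast; omega)) (ih hc) ?_ ?_
    · intro p
      exact intervalIntegral.integral_hasDerivAt_right
        ((by fun_prop : Continuous fun σ => h (σ, p.2)).intervalIntegrable _ _)
        ((by fun_prop : Continuous fun σ => h (σ, p.2)).stronglyMeasurableAtFilter _ _)
        (by fun_prop : Continuous fun σ => h (σ, p.2)).continuousAt
    · intro p
      exact aux_param_deriv hh' hc.continuous hd p.1 p.2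

lemma aux_bounds {g : ℝ × ℝ → ℝ} {n : WithTop ℕ∞} (hg : ContDiff ℝ n g) (hn : 1 ≤ n) {K : ℝ}
    (hK : ∀ p : ℝ × ℝ, K ≤ |p.2| → g p = 0) (T : ℝ) :
    ∃ M : ℝ, 0 ≤ M ∧ ∀ t u : ℝ, |t| ≤ T → |g (t, u)| ≤ M ∧ |fderiv ℝ g (t, u) (0, 1)| ≤ M := by
  have hc : Continuous fun p : ℝ × ℝ => fderiv ℝ g p (0, 1) := by
    have : Continuous (fderiv ℝ g) := hg.continuous_fderiv (by
      intro h; rw [h] at hn; simp at hn)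
    exact this.clm_apply continuous_const
  have hcomp : IsCompact (Metric.closedBall (0:ℝ) T ×ˢ Metric.closedBall (0:ℝ) K) :=
    (isCompact_closedBall _ _).prod (isCompact_closedBall _ _)
  obtain ⟨M1, hM1⟩ := hcomp.exists_bound_of_continuousOn hg.continuous.continuousOn
  obtain ⟨M2, hM2⟩ := hcomp.exists_bound_of_continuousOn hc.continuousOn
  refine ⟨max 0 (max M1 M2), le_max_left _ _, fun t u ht => ?_⟩
  rcases le_or_gt |u| K with hu | hu
  · have hmem : ((t, u) : ℝ × ℝ) ∈ Metric.closedBall (0:ℝ) T ×ˢ Metric.closedBall (0:ℝ) K := by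
      simp [ht, hu]
    exact ⟨(hM1 _ hmem).trans (by simp), (hM2 _ hmem).trans (by simp)⟩
  · have hev : g =ᶠ[𝓝 (t, u)] fun _ => 0 := by
      have : ∀ᶠ p : ℝ × ℝ in 𝓝 (t, u), K < |p.2| :=
        (by fun_prop : Continuous fun p : ℝ × ℝ => |p.2|).continuousAt.eventually (lt_mem_nhds hu)
      filter_upwards [this] with p hp using hK p hp.le
    rw [hev.fderiv_eq, hev.eq_of_nhds]
    simp

lemma aux_partial {g : ℝ × ℝ → ℝ} (hg : Differentiable ℝ g) (p : ℝ × ℝ) :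
    HasDerivAt (fun c => g (p.1, c)) (fderiv ℝ g p (0, 1)) p.2 := by
  have h1 := (hg p).hasFDerivAt
  have h2 : HasDerivAt (fun c : ℝ => (p.1, c)) ((0:ℝ), (1:ℝ)) p.2 :=
    (hasDerivAt_const _ _).prodMk (hasDerivAt_id _)
  exact h1.comp_hasDerivAt p.2 h2

lemma aux_lip {g : ℝ × ℝ → ℝ} (hd : Differentiable ℝ g) {T M : ℝ} (hM0 : 0 ≤ M)
    (hM : ∀ t u : ℝ, |t| ≤ T → |g (t, u)| ≤ M ∧ |fderiv ℝ g (t, u) (0, 1)| ≤ M) (t : ℝ) (ht : |t| ≤ T) :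
    LipschitzWith ⟨M, hM0⟩ (fun u => g (t, u)) := by
  refine lipschitzWith_of_nnnorm_deriv_le (fun u => (aux_partial hd (t, u)).differentiableAt) ?_
  intro u
  rw [(aux_partial hd (t, u)).deriv]
  exact NNReal.coe_le_coe.1 (hM t u ht).2

/-- Global existence. -/
lemma aux_exists {g : ℝ × ℝ → ℝ} (hg : ContDiff ℝ (⊤ : ℕ∞) g) {K : ℝ}
    (hK : ∀ p : ℝ × ℝ, K ≤ |p.2| → g p = 0) (c : ℝ) :
    ∃ α : ℝ → ℝ, α 0 = c ∧ ∀ t, HasDerivAt α (g (t, α t)) t := by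
  have hd : Differentiable ℝ g := hg.differentiable (by simp)
  have hcont := hg.continuous
  have step : ∀ n : ℕ, ∃ α : ℝ → ℝ, α 0 = c ∧ ∀ t ∈ Icc (-((n:ℝ)+1)) ((n:ℝ)+1),
      HasDerivWithinAt α (g (t, α t)) (Icc (-((n:ℝ)+1)) ((n:ℝ)+1)) t := by
    intro n
    obtain ⟨M, hM0, hM⟩ := aux_bounds hg (by simp) hK ((n:ℝ)+1)
    have hn : (0:ℝ) ≤ (n:ℝ) := Nat.cast_nonneg n
    have hpl : IsPicardLindelof (fun t u => g (t, u)) (tmin := -((n:ℝ)+1)) (tmax := (n:ℝ)+1)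
        ⟨0, by constructor <;> linarith⟩ c (⟨M * (n+1), by positivity⟩) 0 ⟨M, hM0⟩ ⟨M, hM0⟩ := by
      constructor
      · intro t ht
        exact (aux_lip hd hM0 hM t (abs_le.2 ht)).lipschitzOnWith
      · intro x _
        fun_prop
      · intro t ht x _
        exact (hM t x (abs_le.2 ht)).1
      · simp
        exact le_rfl
    exact hpl.exists_eq_forall_mem_Icc_hasDerivWithinAt₀
  choose α h0 hα using step
  have hαd : ∀ n : ℕ, ∀ t ∈ Ioo (-((n:ℝ)+1)) ((n:ℝ)+1), HasDerivAt (α n) (g (t, α n t)) t :=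
    fun n t ht => (hα n t (Ioo_subset_Icc_self ht)).hasDerivAt (Icc_mem_nhds ht.1 ht.2)
  have huniq : ∀ m n : ℕ, m ≤ n → EqOn (α m) (α n) (Icc (-((m:ℝ)+1)) ((m:ℝ)+1)) := by
    intro m n hmn
    have hmn' : (m:ℝ) ≤ n := by exact_mod_cast hmn
    have hm : (0:ℝ) ≤ (m:ℝ) := Nat.cast_nonneg m
    obtain ⟨M, hM0, hM⟩ := aux_bounds hg (by simp) hK ((m:ℝ)+1)
    refine ODE_solution_unique_of_mem_Icc (v := fun t u => g (t, u)) (s := fun _ => univ)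
      (K := ⟨M, hM0⟩) (t₀ := 0)
      (fun t ht => (aux_lip hd hM0 hM t (abs_le.2 (Ioo_subset_Icc_self ht))).lipschitzOnWith)
      (by constructor <;> linarith)
      (fun t ht => (hα m t ht).continuousWithinAt) (fun t ht => hαd m t ht) (by simp)
      (fun t ht => ((hα n t ?_).continuousWithinAt).mono ?_) (fun t ht => hαd n t ?_) (by simp)
      (by rw [h0, h0])
    · exact ⟨by linarith [ht.1], by linarith [ht.2]⟩
    · exact Icc_subset_Icc (by linarith) (by linarith)
    · exact ⟨by linarith [ht.1], by linarith [ht.2]⟩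
  have key : ∀ (N : ℕ) (s : ℝ), |s| ≤ (N:ℝ) + 1 → α (⌈|s|⌉₊) s = α N s := by
    intro N s hs
    have h1 : |s| ≤ (⌈|s|⌉₊ : ℝ) := Nat.le_ceil _
    rcases le_total (⌈|s|⌉₊) N with h | h
    · exact huniq _ _ h (abs_le.1 (by linarith))
    · exact (huniq _ _ h (abs_le.1 hs)).symm
  refine ⟨fun t => α (⌈|t|⌉₊) t, by simp [h0], fun t => ?_⟩
  have h1 : |t| ≤ (⌈|t|⌉₊ : ℝ) := Nat.le_ceil _
  refine (hαd (⌈|t|⌉₊) t (abs_lt.1 (by linarith))).congr_of_eventuallyEq ?_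
  have : ∀ᶠ s in 𝓝 t, |s| < (⌈|t|⌉₊ : ℝ) + 1 :=
    continuous_abs.continuousAt.eventually (gt_mem_nhds (by linarith))
  filter_upwards [this] with s hs using key _ s hs.le

lemma aux_shear (b e : ℝ) (he : e ≠ 0) : ∃ E : (ℝ × ℝ) ≃L[ℝ] (ℝ × ℝ), ∀ q : ℝ × ℝ, E q = (q.1, b * q.1 + e * q.2) := by
  refine ⟨ContinuousLinearEquiv.equivOfInverse
    ((ContinuousLinearMap.fst ℝ ℝ ℝ).prod
      (b • ContinuousLinearMap.fst ℝ ℝ ℝ + e • ContinuousLinearMap.snd ℝ ℝ ℝ))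
    ((ContinuousLinearMap.fst ℝ ℝ ℝ).prod
      ((-b / e) • ContinuousLinearMap.fst ℝ ℝ ℝ + (1 / e) • ContinuousLinearMap.snd ℝ ℝ ℝ)) ?_ ?_, ?_⟩
  · intro q
    ext <;> simp
    field_simp; ring
  · intro q
    ext <;> simp
    field_simp; ring
  · intro q
    simp

/-- The flow box lemma for scalar ODE with compactly supported right-hand side in space. -/
lemma ode_main {g : ℝ × ℝ → ℝ} (hg : ContDiff ℝ (⊤ : ℕ∞) g) {K : ℝ}
    (hK : ∀ p : ℝ × ℝ, K ≤ |p.2| → g p = 0) :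
    ∃ G F : ℝ × ℝ → ℝ, ContDiff ℝ (⊤ : ℕ∞) G ∧ ContDiff ℝ (⊤ : ℕ∞) F ∧ (∀ c, G (0, c) = c) ∧
      (∀ t c, HasDerivAt (fun s => G (s, c)) (g (t, G (t, c))) t) ∧
      (∀ t c, F (t, G (t, c)) = c) ∧ (∀ t u, G (t, F (t, u)) = u) ∧
      (∀ p : ℝ × ℝ, ∃ k : ℝ, 0 < k ∧ HasFDerivAt F
        ((-g p * k) • ContinuousLinearMap.fst ℝ ℝ ℝ + k • ContinuousLinearMap.snd ℝ ℝ ℝ) p) := by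
  have hd : Differentiable ℝ g := hg.differentiable (by simp)
  have hcont := hg.continuous
  choose α hα0 hαd using fun c => aux_exists hg hK c
  set gu : ℝ × ℝ → ℝ := fun p => fderiv ℝ g p (0, 1) with hgu
  have hguC : ContDiff ℝ (⊤ : ℕ∞) gu := by
    have : ContDiff ℝ (⊤ : ℕ∞) (fderiv ℝ g) := hg.fderiv_right (by simp)
    exact this.clm_apply contDiff_const
  have hguc : Continuous gu := hguC.continuous
  have hαc : ∀ c, Continuous (α c) := fun c =>
    continuous_iff_continuousAt.2 fun t => (hαd c t).continuousAt
  set G : ℝ × ℝ → ℝ := fun p => α p.2 p.1 with hG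
  -- the averaged derivative
  set A : ℝ × ℝ × ℝ → ℝ := fun p => ∫ θ in (0:ℝ)..1, gu (p.1, p.2.1 + θ * (p.2.2 - p.2.1)) with hA
  have hAc : Continuous A :=
    intervalIntegral.continuous_parametric_intervalIntegral_of_continuous
      (f := fun (p : ℝ × ℝ × ℝ) θ => gu (p.1, p.2.1 + θ * (p.2.2 - p.2.1))) (by fun_prop)
      continuous_const
  have hAeq : ∀ t y y', g (t, y') - g (t, y) = A (t, y, y') * (y' - y) := by
    intro t y y'
    have h1 : ∀ θ ∈ uIcc (0:ℝ) 1, HasDerivAt (fun θ => g (t, y + θ * (y' - y)))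
        (gu (t, y + θ * (y' - y)) * (y' - y)) θ := by
      intro θ _
      have := (aux_partial hd (t, y + θ * (y' - y))).comp θ
        (((hasDerivAt_id θ).mul_const (y' - y)).const_add y)
      rw [one_mul] at this
      exact this
    have := intervalIntegral.integral_eq_sub_of_hasDerivAt h1
      (Continuous.intervalIntegrable (by fun_prop) _ _)
    rw [intervalIntegral.integral_mul_const] at this
    simpa using this.symm
  have hAdiag : ∀ t y, A (t, y, y) = gu (t, y) := by
    intro t y
    simp [hA]
  have hw : ∀ t c c', G (t, c') - G (t, c) =
      (c' - c) * Real.exp (∫ s in (0:ℝ)..t, A (s, α c s, α c' s)) := by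
    intro t c c'
    have hac : Continuous fun s => A (s, α c s, α c' s) := by
      have := hαc c; have := hαc c'
      fun_prop
    have hI : ∀ s, HasDerivAt (fun t => ∫ s in (0:ℝ)..t, A (s, α c s, α c' s))
        (A (s, α c s, α c' s)) s := fun s => hac.integral_hasStrictDerivAt 0 s |>.hasDerivAt
    have hder : ∀ s, HasDerivAt (fun t => (α c' t - α c t) *
        Real.exp (-∫ s in (0:ℝ)..t, A (s, α c s, α c' s))) 0 s := by
      intro s
      have h1 := ((hαd c' s).sub (hαd c s)).mul ((hI s).neg.exp)
      refine h1.congr_deriv ?_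
      rw [hAeq]
      simp only [Pi.sub_apply, Pi.neg_apply]
      ring
    have hconst := is_const_of_deriv_eq_zero (fun s => (hder s).differentiableAt)
      (fun s => (hder s).deriv) t 0
    simp only [intervalIntegral.integral_same, neg_zero, Real.exp_zero, mul_one, hα0] at hconst
    simp only [hG]
    rw [← hconst, mul_assoc, ← Real.exp_add]
    simp
  have hlip : ∀ T : ℝ, ∃ B : ℝ, ∀ t c c', |t| ≤ T → |G (t, c') - G (t, c)| ≤ B * |c' - c| := by
    intro T
    obtain ⟨M, hM0, hM⟩ := aux_bounds hg (by simp) hK T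
    refine ⟨Real.exp (M * T), fun t c c' ht => ?_⟩
    rw [hw, abs_mul, mul_comm, Real.abs_exp]
    refine mul_le_mul_of_nonneg_right (Real.exp_le_exp.2 ?_) (abs_nonneg _)
    have h1 : ‖∫ s in (0:ℝ)..t, A (s, α c s, α c' s)‖ ≤ M * |t - 0| := by
      refine intervalIntegral.norm_integral_le_of_norm_le_const ?_
      intro s hs
      have hs' : |s| ≤ T := by
        have := uIoc_subset_uIcc hs
        rw [mem_uIcc] at this
        rw [abs_le] at ht ⊢
        rcases this with h | h <;> constructor <;> linarith
      have h2 : ‖A (s, α c s, α c' s)‖ ≤ M * |(1:ℝ) - 0| := by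
        refine intervalIntegral.norm_integral_le_of_norm_le_const ?_
        intro θ _
        exact (hM s _ hs').2
      simpa using h2
    have h2 := le_of_abs_le h1
    rw [sub_zero] at h2
    exact h2.trans (mul_le_mul_of_nonneg_left ht hM0)
  have hGc : Continuous G := by
    rw [continuous_iff_continuousAt]
    intro p
    obtain ⟨B, hB⟩ := hlip (|p.1| + 1)
    have hT : ∀ᶠ q : ℝ × ℝ in 𝓝 p, |q.1| ≤ |p.1| + 1 := by
      have : ∀ᶠ q : ℝ × ℝ in 𝓝 p, |q.1| < |p.1| + 1 :=
        (by fun_prop : Continuous fun q : ℝ × ℝ => |q.1|).continuousAt.eventually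
          (gt_mem_nhds (by linarith))
      exact this.mono fun q hq => hq.le
    have h1 : Tendsto (fun q : ℝ × ℝ => G q - G (q.1, p.2)) (𝓝 p) (𝓝 0) := by
      refine squeeze_zero_norm' (a := fun q => B * |q.2 - p.2|) ?_ ?_
      · filter_upwards [hT] with q hq using hB q.1 p.2 q.2 hq
      · have : Continuous fun q : ℝ × ℝ => B * |q.2 - p.2| := by fun_prop
        simpa using this.tendsto p
    have h2 : Tendsto (fun q : ℝ × ℝ => G (q.1, p.2)) (𝓝 p) (𝓝 (G p)) := by
      have : Continuous fun q : ℝ × ℝ => α p.2 q.1 := (hαc p.2).comp continuous_fst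
      exact this.tendsto p
    have := h1.add h2
    simpa [ContinuousAt] using this
  have hGt : ∀ p : ℝ × ℝ, HasDerivAt (fun t => G (t, p.2)) (g (p.1, G p)) p.1 :=
    fun p => hαd p.2 p.1
  set E : ℝ × ℝ → ℝ := fun p => Real.exp (∫ s in (0:ℝ)..p.1, gu (s, G (s, p.2))) with hE
  have hGcd : ∀ p : ℝ × ℝ, HasDerivAt (fun c => G (p.1, c)) (E p) p.2 := by
    rintro ⟨t, c⟩
    rw [hasDerivAt_iff_tendsto_slope]
    have hQ : Continuous fun c' => Real.exp (∫ s in (0:ℝ)..t, A (s, α c s, α c' s)) := by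
      refine Real.continuous_exp.comp ?_
      refine intervalIntegral.continuous_parametric_intervalIntegral_of_continuous
        (f := fun c' s => A (s, α c s, α c' s)) ?_ continuous_const
      have h1 := hαc c
      have h2 : Continuous fun q : ℝ × ℝ => α q.1 q.2 := hGc.comp continuous_swap
      change Continuous fun q : ℝ × ℝ => A (q.2, α c q.2, α q.1 q.2)
      fun_prop
    have h1 := (hQ.tendsto c).mono_left (nhdsWithin_le_nhds (s := {c}ᶜ))
    simp only [hAdiag] at h1
    refine h1.congr' ?_
    filter_upwards [self_mem_nhdsWithin] with c' hc'
    have : c' - c ≠ 0 := sub_ne_zero.2 hc'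
    rw [slope_def_field, hw]
    field_simp
  have hGn : ∀ n : ℕ, ContDiff ℝ n G := by
    intro n
    induction n with
    | zero => simpa using hGc
    | succ n ih =>
      push_cast
      refine aux_contDiff_succ (a := fun p => g (p.1, G p)) (b := E) ?_ ?_ hGt hGcd
      · exact (hg.of_le (by exact_mod_cast le_top)).comp (contDiff_fst.prodMk ih)
      · refine Real.contDiff_exp.comp ?_
        refine aux_param_contDiff n (h := fun q => gu (q.1, G q)) ?_
        exact (hguC.of_le (by exact_mod_cast le_top)).comp (contDiff_fst.prodMk ih)
  have hGs : ContDiff ℝ (⊤ : ℕ∞) G := contDiff_infty.2 hGn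
  have hinj : ∀ t c c', G (t, c) = G (t, c') → c = c' := by
    intro t c c' h
    have h1 := hw t c c'
    rw [h, sub_self] at h1
    rcases mul_eq_zero.1 h1.symm with h2 | h2
    · linarith
    · exact absurd h2 (Real.exp_pos _).ne'
  have hsurj : ∀ t u, ∃ c, G (t, c) = u := by
    intro t u
    obtain ⟨M, hM0, hM⟩ := aux_bounds hg (by simp) hK |t|
    have hb : ∀ c, |G (t, c) - c| ≤ M * |t| := by
      intro c
      have := Convex.norm_image_sub_le_of_norm_hasDerivWithin_le (s := Icc (-|t|) |t|)
        (f := α c) (f' := fun s => g (s, α c s)) (C := M) (x := 0) (y := t)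
        (fun s _ => (hαd c s).hasDerivWithinAt)
        (fun s hs => (hM s _ (abs_le.2 hs)).1) (convex_Icc (-|t|) |t|)
        ⟨by simp, by simp⟩ ⟨neg_abs_le t, le_abs_self t⟩
      simpa [hα0] using this
    have hct : Continuous fun c => G (t, c) := by fun_prop
    have := mem_range_of_exists_le_of_exists_ge hct (c := u)
      ⟨u - M * |t|, by have := abs_le.1 (hb (u - M * |t|)); linarith [this.2]⟩
      ⟨u + M * |t|, by have := abs_le.1 (hb (u + M * |t|)); linarith [this.1]⟩
    exact this
  choose F0 hF0 using hsurj
  have hGfd := aux_hasFDerivAt (H := G) (a := fun p => g (p.1, G p)) (b := E) (by fun_prop)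
    (by
      refine Real.continuous_exp.comp ?_
      refine intervalIntegral.continuous_parametric_intervalIntegral_of_continuous
        (f := fun (q : ℝ × ℝ) s => gu (s, G (s, q.2))) (by fun_prop) continuous_fst) hGt hGcd
  set F : ℝ × ℝ → ℝ := fun p => F0 p.1 p.2 with hF
  have hFG : ∀ t c, F (t, G (t, c)) = c := fun t c => hinj t _ _ (hF0 t _)
  have hGF : ∀ t u, G (t, F (t, u)) = u := fun t u => hF0 t u
  have hFs : ContDiff ℝ (⊤ : ℕ∞) F := by
    rw [contDiff_iff_contDiffAt]
    rintro ⟨t, u⟩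
    set c := F (t, u) with hc
    set Φ : ℝ × ℝ → ℝ × ℝ := fun q => (q.1, G q) with hΦ
    have hΦs : ContDiffAt ℝ (⊤ : ℕ∞) Φ (t, c) := (contDiff_fst.prodMk hGs).contDiffAt
    have hEpos : E (t, c) ≠ 0 := (Real.exp_pos _).ne'
    obtain ⟨L, hL⟩ := aux_shear (g (t, G (t, c))) (E (t, c)) hEpos
    have hΦd : HasFDerivAt Φ (L : (ℝ × ℝ) →L[ℝ] (ℝ × ℝ)) (t, c) := by
      refine (hasFDerivAt_fst.prodMk (hGfd (t, c))).congr_fderiv ?_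
      apply ContinuousLinearMap.ext
      intro q
      simp [hL]
    have hloc := hΦs.to_localInverse hΦd (by simp)
    have hΦv : Φ (t, c) = (t, u) := by simp [hΦ, hc, hGF]
    rw [hΦv] at hloc
    refine (contDiff_snd.contDiffAt.comp _ hloc).congr_of_eventuallyEq ?_
    have hr := (hΦs.hasStrictFDerivAt' hΦd (by simp)).eventually_right_inverse
    rw [hΦv] at hr
    filter_upwards [hr] with q hq
    have h1 := congrArg Prod.fst hq
    have h2 := congrArg Prod.snd hq
    simp only [hΦ] at h1 h2
    simp only [Function.comp]
    apply hinj q.1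
    rw [hGF, ← h2]
    congr 1
    exact Prod.ext h1 rfl
  refine ⟨G, F, hGs, hFs, fun c => hα0 c, fun t c => hGt (t, c), hFG, hGF, ?_⟩
  rintro ⟨t, u⟩
  have hFd : HasFDerivAt F (fderiv ℝ F (t, u)) (t, u) :=
    (hFs.differentiable (by simp) (t, u)).hasFDerivAt
  set D := fderiv ℝ F (t, u) with hD
  set c := F (t, u) with hc
  have hEpos : 0 < E (t, c) := Real.exp_pos _
  have hu : G (t, c) = u := hGF t u
  have e1 : D (0, 1) * E (t, c) = 1 := by
    have h1 : HasDerivAt (fun c => (t, G (t, c))) ((0:ℝ), E (t, c)) c :=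
      (hasDerivAt_const _ _).prodMk (hGcd (t, c))
    have h2 : HasDerivAt (fun c' => F (t, G (t, c'))) (D (0, E (t, c))) c :=
      HasFDerivAt.comp_hasDerivAt (l := F) c (by rw [hu]; exact hFd) h1
    have h3 : (fun c' => F (t, G (t, c'))) = fun c' => c' := funext (hFG t)
    rw [h3] at h2
    have h4 := h2.unique (hasDerivAt_id c)
    have h5 : ((0:ℝ), E (t, c)) = E (t, c) • ((0:ℝ), (1:ℝ)) := by simp
    rw [h5, map_smul, smul_eq_mul] at h4
    linarith
  have e2 : D (1, 0) + g (t, u) * D (0, 1) = 0 := by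
    have h1 : HasDerivAt (fun s => (s, G (s, c))) ((1:ℝ), g (t, u)) t := by
      have := (hasDerivAt_id t).prodMk (hGt (t, c))
      simpa [hu] using this
    have h2 : HasDerivAt (fun s => F (s, G (s, c))) (D (1, g (t, u))) t :=
      HasFDerivAt.comp_hasDerivAt (l := F) t (by rw [hu]; exact hFd) h1
    have h3 : (fun s => F (s, G (s, c))) = fun s => c := funext fun s => hFG s c
    rw [h3] at h2
    have h4 := h2.unique (hasDerivAt_const t c)
    have h5 : ((1:ℝ), g (t, u)) = (1, 0) + g (t, u) • ((0:ℝ), (1:ℝ)) := by simp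
    rw [h5, map_add, map_smul, smul_eq_mul] at h4
    exact h4
  refine ⟨D (0, 1), ?_, hFd.congr_fderiv ?_⟩
  · by_contra h
    push Not at h
    nlinarith
  · have e3 : D (1, 0) = -g (t, u) * D (0, 1) := by linarith
    ext <;> simp [e3]

lemma inv_smooth {p : ℝ → ℝ} (hp : ContDiff ℝ (⊤ : ℕ∞) p) (hinj : Function.Injective p)
    (hd : ∀ t, deriv p t ≠ 0) :
    ∃ P : ℝ → ℝ, (∀ t, P (p t) = t) ∧ (∀ t, range p ∈ 𝓝 (p t)) ∧
      (∀ t, ContDiffAt ℝ (⊤ : ℕ∞) P (p t)) ∧ (∀ t, HasDerivAt P (deriv p t)⁻¹ (p t)) := by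
  have hP : ∀ t, Function.invFun p (p t) = t := Function.leftInverse_invFun hinj
  have hs : ∀ t, HasStrictDerivAt p (deriv p t) t := fun t =>
    (hp.contDiffAt (x := t)).hasStrictDerivAt (by simp)
  have hr : ∀ t, range p ∈ 𝓝 (p t) := by
    intro t
    have := (hs t).map_nhds_eq (hd t)
    rw [← this]
    exact range_mem_map
  have hc : ∀ t, ContDiffAt ℝ (⊤ : ℕ∞) (Function.invFun p) (p t) := by
    intro t
    have hfd := (hs t).hasDerivAt.hasFDerivAt_equiv (hd t)
    have hloc := (hp.contDiffAt (x := t)).to_localInverse hfd (by simp)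
    refine hloc.congr_of_eventuallyEq ?_
    have hr := ((hp.contDiffAt (x := t)).hasStrictFDerivAt' hfd (by simp)).eventually_right_inverse
    filter_upwards [hr] with c hc
    apply hinj
    have : ∃ a, p a = c := ⟨_, hc⟩
    rw [Function.invFun_eq this]
    exact hc.symm
  refine ⟨Function.invFun p, hP, hr, hc, fun t => ?_⟩
  have h1 := ((hc t).differentiableAt (by simp)).hasDerivAt
  have h2 := HasDerivAt.comp t h1 (hs t).hasDerivAt
  have h3 : Function.invFun p ∘ p = id := funext hP
  rw [h3] at h2
  have h4 := h2.unique (hasDerivAt_id t)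
  rwa [eq_inv_of_mul_eq_one_left h4] at h1

lemma core_psi {um up : ℝ} (hlt : um < up) {g F : ℝ × ℝ → ℝ} (hF : ContDiff ℝ (⊤ : ℕ∞) F)
    (hF0 : ∀ u, F (0, u) = u)
    (hFd : ∀ p : ℝ × ℝ, ∃ k : ℝ, 0 < k ∧ HasFDerivAt F
        ((-g p * k) • ContinuousLinearMap.fst ℝ ℝ ℝ + k • ContinuousLinearMap.snd ℝ ℝ ℝ) p)
    (hup : ∀ τ, g (τ, up) < 0) (hum : ∀ τ, 0 < g (τ, um))
    {Q : ℝ → ℝ} (hQ : ContDiff ℝ (⊤ : ℕ∞) Q) (hQd : ∀ c ∈ Ioo um up, 0 < deriv Q c)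
    (hQp : 0 < Q up) (hQm : Q um < 0)
    (hlin : ∀ τ ≤ 0, ∀ u ∈ Icc um up, Q (F (τ, u)) = Real.exp (2 * τ) * Q u) :
    ∃ ψ : ℝ → ℝ, (∀ τ, ∀ u ∈ Icc um up, ContDiffAt ℝ (⊤ : ℕ∞) ψ (F (τ, u)) ∧
        ∀ᶠ c in 𝓝 (F (τ, u)), ∃ m, 0 < m ∧ HasDerivAt ψ m c) ∧
      (∀ τ, ψ (F (τ, up)) = Real.exp (2 * τ) * Q up) ∧
      (∀ τ, ψ (F (τ, um)) = Real.exp (2 * τ) * Q um) ∧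
      (∀ τ < 0, ∀ u ∈ Icc um up, ψ (F (τ, u)) = Real.exp (2 * τ) * Q u) := by
  -- monotonicity in u
  have hmono : ∀ τ, StrictMono fun u => F (τ, u) := by
    intro τ
    refine strictMono_of_deriv_pos fun u => ?_
    obtain ⟨k, hk, hd⟩ := hFd (τ, u)
    have h1 : HasDerivAt (fun u => (τ, u)) ((0:ℝ), (1:ℝ)) u :=
      (hasDerivAt_const _ _).prodMk (hasDerivAt_id u)
    have h2 : HasDerivAt (fun u => F (τ, u)) _ u := HasFDerivAt.comp_hasDerivAt (l := F) u hd h1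
    rw [h2.deriv]
    simpa using hk
  have hpd : ∀ u τ, ∃ k, 0 < k ∧ deriv (fun τ => F (τ, u)) τ = -g (τ, u) * k := by
    intro u τ
    obtain ⟨k, hk, hd⟩ := hFd (τ, u)
    have h1 : HasDerivAt (fun τ => (τ, u)) ((1:ℝ), (0:ℝ)) τ :=
      (hasDerivAt_id τ).prodMk (hasDerivAt_const _ _)
    have h2 : HasDerivAt (fun τ => F (τ, u)) _ τ := HasFDerivAt.comp_hasDerivAt (l := F) τ hd h1
    refine ⟨k, hk, ?_⟩
    rw [h2.deriv]
    simp
  set p : ℝ → ℝ := fun τ => F (τ, up) with hp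
  set pm : ℝ → ℝ := fun τ => F (τ, um) with hpm
  have hpC : ContDiff ℝ (⊤ : ℕ∞) p := hF.comp (contDiff_id.prodMk contDiff_const)
  have hpmC : ContDiff ℝ (⊤ : ℕ∞) pm := hF.comp (contDiff_id.prodMk contDiff_const)
  have hp' : ∀ τ, 0 < deriv p τ := by
    intro τ
    obtain ⟨k, hk, h⟩ := hpd up τ
    rw [h]
    have := hup τ
    nlinarith
  have hpm' : ∀ τ, deriv pm τ < 0 := by
    intro τ
    obtain ⟨k, hk, h⟩ := hpd um τ
    rw [h]
    have := hum τ
    nlinarith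
  have hpmono : StrictMono p := strictMono_of_deriv_pos hp'
  have hpmanti : StrictAnti pm := strictAnti_of_deriv_neg hpm'
  have hp0 : p 0 = up := hF0 up
  have hpm0 : pm 0 = um := hF0 um
  have hpp : ∀ τ, pm τ < p τ := fun τ => hmono τ hlt
  have hdisj : ∀ τ σ, p τ ≠ pm σ := by
    intro τ σ h
    have h1 := hpmono.monotone (min_le_left τ σ)
    have h2 := hpmanti.antitone (min_le_right τ σ)
    have h3 := hpp (min τ σ)
    linarith
  obtain ⟨P, hP1, hP2, hP3, hP4⟩ := inv_smooth hpC hpmono.injective (fun t => (hp' t).ne')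
  obtain ⟨M, hM1, hM2, hM3, hM4⟩ := inv_smooth hpmC hpmanti.injective (fun t => (hpm' t).ne)
  classical
  set ψ : ℝ → ℝ := fun c => if c ∈ Ioo um up then Q c else
    if c ∈ range p then Real.exp (2 * P c) * Q up else Real.exp (2 * M c) * Q um with hψ
  have hA : ∀ c ∈ Ioo um up, ψ c = Q c := fun c hc => if_pos hc
  have hB : ∀ c ∈ range p, ψ c = Real.exp (2 * P c) * Q up := by
    rintro _ ⟨τ, rfl⟩
    by_cases h : p τ ∈ Ioo um up
    · rw [hA _ h, hP1]
      have : τ < 0 := by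
        rw [← hpmono.lt_iff_lt, hp0]; exact h.2
      exact hlin τ this.le up ⟨hlt.le, le_rfl⟩
    · simp only [hψ]
      rw [if_neg h, if_pos (mem_range_self τ)]
  have hC : ∀ c ∈ range pm, ψ c = Real.exp (2 * M c) * Q um := by
    rintro _ ⟨τ, rfl⟩
    by_cases h : pm τ ∈ Ioo um up
    · rw [hA _ h, hM1]
      have : τ < 0 := by
        rw [← hpmanti.lt_iff_gt, hpm0]; exact h.1
      exact hlin τ this.le um ⟨le_rfl, hlt.le⟩
    · have h2 : pm τ ∉ range p := by
        rintro ⟨σ, hσ⟩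
        exact hdisj _ _ hσ
      simp only [hψ]
      rw [if_neg h, if_neg h2]
  -- the good set
  have key : ∀ c, (c ∈ Ioo um up ∨ c ∈ range p ∨ c ∈ range pm) →
      ContDiffAt ℝ (⊤ : ℕ∞) ψ c ∧ ∃ m, 0 < m ∧ HasDerivAt ψ m c := by
    rintro c (h | ⟨τ, rfl⟩ | ⟨τ, rfl⟩)
    · have he : ψ =ᶠ[𝓝 c] Q := by
        filter_upwards [isOpen_Ioo.mem_nhds h] with c' hc' using hA c' hc'
      refine ⟨hQ.contDiffAt.congr_of_eventuallyEq he, deriv Q c, hQd c h, ?_⟩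
      exact (hQ.differentiable (by simp) c).hasDerivAt.congr_of_eventuallyEq he
    · have he : ψ =ᶠ[𝓝 (p τ)] fun c => Real.exp (2 * P c) * Q up := by
        filter_upwards [hP2 τ] with c' hc' using hB c' hc'
      refine ⟨ContDiffAt.congr_of_eventuallyEq ?_ he, _, ?_,
        (((hP4 τ).const_mul 2).exp.mul_const (Q up)).congr_of_eventuallyEq he⟩
      · exact ((contDiffAt_const.mul (hP3 τ)).exp).mul contDiffAt_const
      · have := hp' τ
        positivity
    · have he : ψ =ᶠ[𝓝 (pm τ)] fun c => Real.exp (2 * M c) * Q um := by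
        filter_upwards [hM2 τ] with c' hc' using hC c' hc'
      refine ⟨ContDiffAt.congr_of_eventuallyEq ?_ he, _, ?_,
        (((hM4 τ).const_mul 2).exp.mul_const (Q um)).congr_of_eventuallyEq he⟩
      · exact ((contDiffAt_const.mul (hM3 τ)).exp).mul contDiffAt_const
      · have h1 : (deriv pm τ)⁻¹ < 0 := inv_lt_zero.2 (hpm' τ)
        have h2 := Real.exp_pos (2 * M (pm τ))
        have h3 : Real.exp (2 * M (pm τ)) * (2 * (deriv pm τ)⁻¹) < 0 :=
          mul_neg_of_pos_of_neg h2 (by linarith)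
        exact mul_pos_of_neg_of_neg h3 hQm
  have keyn : ∀ c, (c ∈ Ioo um up ∨ c ∈ range p ∨ c ∈ range pm) →
      ∀ᶠ c' in 𝓝 c, (c' ∈ Ioo um up ∨ c' ∈ range p ∨ c' ∈ range pm) := by
    rintro c (h | ⟨τ, rfl⟩ | ⟨τ, rfl⟩)
    · filter_upwards [isOpen_Ioo.mem_nhds h] with c' hc' using Or.inl hc'
    · filter_upwards [hP2 τ] with c' hc' using Or.inr (Or.inl hc')
    · filter_upwards [hM2 τ] with c' hc' using Or.inr (Or.inr hc')
  have hcov : ∀ τ, ∀ u ∈ Icc um up,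
      (F (τ, u) ∈ Ioo um up ∨ F (τ, u) ∈ range p ∨ F (τ, u) ∈ range pm) := by
    intro τ u hu
    have h1 : pm τ ≤ F (τ, u) := (hmono τ).monotone hu.1
    have h2 : F (τ, u) ≤ p τ := (hmono τ).monotone hu.2
    rcases le_or_gt up (F (τ, u)) with h3 | h3
    · right; left
      exact mem_range_of_exists_le_of_exists_ge hpC.continuous ⟨0, hp0.le.trans h3⟩ ⟨τ, h2⟩
    rcases le_or_gt (F (τ, u)) um with h4 | h4
    · right; right
      exact mem_range_of_exists_le_of_exists_ge hpmC.continuous ⟨τ, h1⟩ ⟨0, h4.trans hpm0.ge⟩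
    · left; exact ⟨h4, h3⟩
  refine ⟨ψ, ?_, ?_, ?_, ?_⟩
  · intro τ u hu
    refine ⟨(key _ (hcov τ u hu)).1, ?_⟩
    filter_upwards [keyn _ (hcov τ u hu)] with c hc using (key c hc).2
  · intro τ
    have := hB (p τ) (mem_range_self τ)
    rwa [hP1] at this
  · intro τ
    have := hC (pm τ) (mem_range_self τ)
    rwa [hM1] at this
  · intro τ hτ u hu
    have h1 : pm τ ≤ F (τ, u) := (hmono τ).monotone hu.1
    have h2 : F (τ, u) ≤ p τ := (hmono τ).monotone hu.2
    have h3 := hpmono hτ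
    have h4 := hpmanti hτ
    rw [hA _ ⟨by linarith, by linarith⟩]
    exact hlin τ hτ.le u hu

lemma cutoff {s O : Set (ℝ × ℝ)} (hs : IsClosed s) (hO : IsOpen O) (hsO : s ⊆ O)
    {h : ℝ × ℝ → ℝ} (hh : ∀ p ∈ O, ContDiffAt ℝ (⊤ : ℕ∞) h p) :
    ∃ g : ℝ × ℝ → ℝ, ContDiff ℝ (⊤ : ℕ∞) g ∧ (∀ p ∈ s, g =ᶠ[𝓝 p] h) ∧ ∀ p ∉ O, g p = 0 := by
  obtain ⟨f, h0, h1, -⟩ := exists_contMDiffMap_zero_one_nhds_of_isClosed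
    (n := (⊤ : ℕ∞)) (modelWithCornersSelf ℝ (ℝ × ℝ)) hO.isClosed_compl hs
    (disjoint_left.2 fun p hp hp' => hp (hsO hp'))
  have hf : ContDiff ℝ (⊤ : ℕ∞) f := contMDiff_iff_contDiff.1 f.contMDiff
  refine ⟨fun p => f p * h p, ?_, ?_, ?_⟩
  · rw [contDiff_iff_contDiffAt]
    intro p
    by_cases hp : p ∈ O
    · exact hf.contDiffAt.mul (hh p hp)
    · have : ∀ᶠ x in 𝓝 p, f x = 0 := h0.filter_mono (nhds_le_nhdsSet hp)
      refine (contDiffAt_const (c := (0:ℝ))).congr_of_eventuallyEq ?_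
      filter_upwards [this] with x hx
      simp [hx]
  · intro p hp
    have : ∀ᶠ x in 𝓝 p, f x = 1 := h1.filter_mono (nhds_le_nhdsSet hp)
    filter_upwards [this] with x hx
    simp [hx]
  · intro p hp
    have : f p = 0 := h0.self_of_nhdsSet p hp
    simp [this]

/-- ODE right-hand side in the chart. -/
lemma core_g {γ ε : ℝ} (hγ : 0 < γ) {φ1 φ2 : ℝ × ℝ → ℝ}
    (h1 : ContDiff ℝ (⊤ : ℕ∞) φ1) (h2 : ContDiff ℝ (⊤ : ℕ∞) φ2)
    (p1 : ∀ p, 0 < φ1 p) (p2 : ∀ p, 0 < φ2 p) :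
    ∃ (g : ℝ × ℝ → ℝ) (K : ℝ), ContDiff ℝ (⊤ : ℕ∞) g ∧ (∀ p : ℝ × ℝ, K ≤ |p.2| → g p = 0) ∧
      ∀ τ, ∀ u ∈ Icc (-2 / γ) (2 * γ / (2 + γ ^ 2)), ∀ᶠ p : ℝ × ℝ in 𝓝 (τ, u), ∃ D, 0 < D ∧
        D = (1 + γ / 2 * p.2) *
            φ2 (ε * Real.exp p.1 * p.2, ε * Real.exp p.1 * (1 - γ / 2 * p.2)) +
          γ / 2 * (γ - (γ ^ 2 / 2 + 1) * p.2) *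
            φ1 (ε * Real.exp p.1 * p.2, ε * Real.exp p.1 * (1 - γ / 2 * p.2)) ∧
        g p = (γ - (γ ^ 2 / 2 + 1) * p.2) *
            φ1 (ε * Real.exp p.1 * p.2, ε * Real.exp p.1 * (1 - γ / 2 * p.2)) / D - p.2 := by
  set c : ℝ × ℝ → ℝ × ℝ :=
    fun p => (ε * Real.exp p.1 * p.2, ε * Real.exp p.1 * (1 - γ / 2 * p.2)) with hc
  have hcC : ContDiff ℝ (⊤ : ℕ∞) c := by
    have : ContDiff ℝ (⊤ : ℕ∞) fun p : ℝ × ℝ => Real.exp p.1 := contDiff_fst.exp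
    exact ((contDiff_const.mul this).mul contDiff_snd).prodMk
      ((contDiff_const.mul this).mul (contDiff_const.sub (contDiff_const.mul contDiff_snd)))
  set D : ℝ × ℝ → ℝ := fun p => (1 + γ / 2 * p.2) * φ2 (c p) +
    γ / 2 * (γ - (γ ^ 2 / 2 + 1) * p.2) * φ1 (c p) with hD
  have hf1 : ContDiff ℝ (⊤ : ℕ∞) fun p => φ1 (c p) := h1.comp hcC
  have hf2 : ContDiff ℝ (⊤ : ℕ∞) fun p => φ2 (c p) := h2.comp hcC
  have hX : ContDiff ℝ (⊤ : ℕ∞) fun p : ℝ × ℝ => (γ - (γ ^ 2 / 2 + 1) * p.2) :=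
    contDiff_const.sub (contDiff_const.mul contDiff_snd)
  have hY : ContDiff ℝ (⊤ : ℕ∞) fun p : ℝ × ℝ => (1 + γ / 2 * p.2) :=
    contDiff_const.add (contDiff_const.mul contDiff_snd)
  have hDC : ContDiff ℝ (⊤ : ℕ∞) D := (hY.mul hf2).add ((contDiff_const.mul hX).mul hf1)
  set K : ℝ := 2 / γ + 2 * γ / (2 + γ ^ 2) + 1 with hK
  set s : Set (ℝ × ℝ) := {p | p.2 ∈ Icc (-2 / γ) (2 * γ / (2 + γ ^ 2))} with hs
  set O : Set (ℝ × ℝ) := {p | 0 < D p ∧ |p.2| < K} with hO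
  have hsc : IsClosed s := isClosed_Icc.preimage continuous_snd
  have hOo : IsOpen O := (isOpen_lt continuous_const hDC.continuous).inter
    (isOpen_lt (continuous_abs.comp continuous_snd) continuous_const)
  have hsO : s ⊆ O := by
    rintro ⟨τ, u⟩ ⟨hu1, hu2⟩
    simp only at hu1 hu2
    have e1 : 0 < 2 / γ := by positivity
    have e2 : 0 < 2 * γ / (2 + γ ^ 2) := by positivity
    constructor
    · have a1 : 0 ≤ 1 + γ / 2 * u := by
        rw [div_le_iff₀ hγ] at hu1
        linarith
      have a2 : 0 ≤ γ - (γ ^ 2 / 2 + 1) * u := by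
        rw [le_div_iff₀ (by positivity)] at hu2
        linarith
      have q1 := p1 (c (τ, u))
      have q2 := p2 (c (τ, u))
      change 0 < (1 + γ / 2 * u) * φ2 (c (τ, u)) +
        γ / 2 * (γ - (γ ^ 2 / 2 + 1) * u) * φ1 (c (τ, u))
      rcases a1.lt_or_eq with a1 | a1
      · have : 0 ≤ γ / 2 * (γ - (γ ^ 2 / 2 + 1) * u) * φ1 (c (τ, u)) := by positivity
        have : 0 < (1 + γ / 2 * u) * φ2 (c (τ, u)) := by positivity
        linarith
      · have a3 : 0 < γ - (γ ^ 2 / 2 + 1) * u := by nlinarith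
        rw [← a1]
        positivity
    · change |u| < K
      rw [abs_lt]
      have : -2 / γ = - (2 / γ) := by ring
      constructor <;> linarith
  obtain ⟨g, hg, hgs, hgO⟩ := cutoff hsc hOo hsO
    (h := fun p => (γ - (γ ^ 2 / 2 + 1) * p.2) * φ1 (c p) / D p - p.2)
    (fun p hp => (((hX.mul hf1).contDiffAt).div hDC.contDiffAt hp.1.ne').sub contDiffAt_snd)
  refine ⟨g, K, hg, fun p hp => hgO p fun h => absurd h.2 (not_lt.2 hp), fun τ u hu => ?_⟩
  have hm : (τ, u) ∈ s := hu
  filter_upwards [hgs _ hm, hOo.mem_nhds (hsO hm)] with p hp hp'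
  exact ⟨D p, hp'.1, rfl, hp⟩

set_option maxHeartbeats 1000000 in
lemma core {γ r0 : ℝ} (hγ : 0 < γ) (hr0 : 0 < r0) {φ1 φ2 : ℝ × ℝ → ℝ}
    (h1 : ContDiff ℝ (⊤ : ℕ∞) φ1) (h2 : ContDiff ℝ (⊤ : ℕ∞) φ2)
    (p1 : ∀ p, 0 < φ1 p) (p2 : ∀ p, 0 < φ2 p)
    (hlow : ∀ p : ℝ × ℝ, p.1 ^ 2 + p.2 ^ 2 ≤ r0 ^ 2 → φ1 p = 1 ∧ φ2 p = 1) :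
    ∃ (f : ℝ × ℝ → ℝ) (r : ℝ), 0 < r ∧
      (∀ z : ℝ × ℝ, 0 ≤ γ * z.2 - z.1 → 0 ≤ z.2 + γ * z.1 → z ≠ 0 →
        ContDiffAt ℝ (⊤ : ℕ∞) f z ∧ ∀ᶠ w : ℝ × ℝ in 𝓝 z, ∃ μ, 0 < μ ∧
          HasFDerivAt f ((μ * ((w.2 + γ * w.1) * φ2 w)) • ContinuousLinearMap.fst ℝ ℝ ℝ +
            (-(μ * ((γ * w.2 - w.1) * φ1 w))) • ContinuousLinearMap.snd ℝ ℝ ℝ) w) ∧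
      (∀ z : ℝ × ℝ, 0 ≤ γ * z.2 - z.1 → 0 ≤ z.2 + γ * z.1 → z ≠ 0 →
        (γ * z.2 - z.1 = 0 ∨ z.2 + γ * z.1 = 0 ∨ z.1 ^ 2 + z.2 ^ 2 < r ^ 2) →
        f z = γ / 2 * z.1 ^ 2 + z.1 * z.2 - γ / 2 * z.2 ^ 2) := by
  set ε : ℝ := r0 * γ / (2 * (1 + γ)) with hε
  have hε0 : 0 < ε := by positivity
  obtain ⟨g, K, hg, hgK, hgs⟩ := core_g (ε := ε) hγ h1 h2 p1 p2
  obtain ⟨G, F, hG, hF, hG0, hGd, hFG, hGF, hFd⟩ := ode_main hg hgK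
  set um : ℝ := -2 / γ with hum
  set up : ℝ := 2 * γ / (2 + γ ^ 2) with hup
  have hup0 : 0 < up := by positivity
  have hum0 : um < 0 := by rw [hum, neg_div]; have : 0 < 2 / γ := by positivity
                           linarith
  have hlt : um < up := hum0.trans hup0
  have hupX : γ - (γ ^ 2 / 2 + 1) * up = 0 := by rw [hup]; field_simp; ring
  have humY : 1 + γ / 2 * um = 0 := by rw [hum]; field_simp; ring
  have hub : ∀ u ∈ Icc um up, 0 < 1 - γ / 2 * u ∧ 1 - γ / 2 * u ≤ 2 ∧ |u| ≤ 2 / γ := by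
    intro u hu
    have e1 : γ / 2 * up < 1 := by
      have : γ * up * (2 + γ ^ 2) = 2 * γ ^ 2 := by rw [hup]; field_simp
      nlinarith [sq_nonneg γ]
    have e2 : γ / 2 * u ≤ γ / 2 * up := mul_le_mul_of_nonneg_left hu.2 (by positivity)
    have e3 : γ / 2 * um ≤ γ / 2 * u := mul_le_mul_of_nonneg_left hu.1 (by positivity)
    refine ⟨by linarith, by linarith, ?_⟩
    have e4 : |u| * γ = |u * γ| := by rw [abs_mul, abs_of_pos hγ]
    rw [le_div_iff₀ hγ, e4, abs_le]
    constructor <;> linarith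
  have hgd : ∀ τ, ∀ u ∈ Icc um up, ∃ D, 0 < D ∧
        D = (1 + γ / 2 * u) * φ2 (ε * Real.exp τ * u, ε * Real.exp τ * (1 - γ / 2 * u)) +
          γ / 2 * (γ - (γ ^ 2 / 2 + 1) * u) *
            φ1 (ε * Real.exp τ * u, ε * Real.exp τ * (1 - γ / 2 * u)) ∧
        g (τ, u) = (γ - (γ ^ 2 / 2 + 1) * u) *
            φ1 (ε * Real.exp τ * u, ε * Real.exp τ * (1 - γ / 2 * u)) / D - u :=
    fun τ u hu => (hgs τ u hu).self_of_nhds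
  have hgup : ∀ τ, g (τ, up) < 0 := by
    intro τ
    obtain ⟨D, hD, -, h⟩ := hgd τ up ⟨hlt.le, le_rfl⟩
    rw [h, hupX]; simpa using hup0
  have hgum : ∀ τ, 0 < g (τ, um) := by
    intro τ
    obtain ⟨D, hD, hD', h⟩ := hgd τ um ⟨le_rfl, hlt.le⟩
    have hX : 0 < γ - (γ ^ 2 / 2 + 1) * um := by nlinarith [sq_nonneg γ]
    have := p1 (ε * Real.exp τ * um, ε * Real.exp τ * (1 - γ / 2 * um))
    have : 0 < (γ - (γ ^ 2 / 2 + 1) * um) *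
      φ1 (ε * Real.exp τ * um, ε * Real.exp τ * (1 - γ / 2 * um)) / D := by positivity
    rw [h]; linarith
  have hF0 : ∀ u, F (0, u) = u := by
    intro u
    have := hFG 0 u
    rwa [hG0] at this
  -- linear regime
  have hphi : ∀ τ ≤ 0, ∀ u ∈ Icc um up,
      φ1 (ε * Real.exp τ * u, ε * Real.exp τ * (1 - γ / 2 * u)) = 1 ∧
      φ2 (ε * Real.exp τ * u, ε * Real.exp τ * (1 - γ / 2 * u)) = 1 := by
    intro τ hτ u hu
    apply hlow
    obtain ⟨b1, b2, b3⟩ := hub u hu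
    have e1 : Real.exp τ ≤ 1 := Real.exp_le_one_iff.2 hτ
    have e2 : (ε * Real.exp τ) ^ 2 ≤ ε ^ 2 := by
      have := Real.exp_pos τ
      apply pow_le_pow_left₀ (by positivity)
      nlinarith
    have e3 : u ^ 2 ≤ (2 / γ) ^ 2 := by
      rw [← sq_abs]; exact pow_le_pow_left₀ (abs_nonneg u) b3 2
    have e4 : (1 - γ / 2 * u) ^ 2 ≤ 4 := by nlinarith
    have e5 : ε ^ 2 * ((2 / γ) ^ 2 + 4) ≤ r0 ^ 2 := by
      have : ε ^ 2 * ((2 / γ) ^ 2 + 4) = r0 ^ 2 * ((1 + γ ^ 2) / (1 + γ) ^ 2) := by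
        rw [hε]; field_simp; ring
      rw [this]
      have : (1 + γ ^ 2) / (1 + γ) ^ 2 ≤ 1 := by
        rw [div_le_one (by positivity)]; nlinarith
      nlinarith [sq_nonneg r0]
    have e6 : (0:ℝ) ≤ u ^ 2 + (1 - γ / 2 * u) ^ 2 := by positivity
    calc (ε * Real.exp τ * u) ^ 2 + (ε * Real.exp τ * (1 - γ / 2 * u)) ^ 2
        = (ε * Real.exp τ) ^ 2 * (u ^ 2 + (1 - γ / 2 * u) ^ 2) := by ring
      _ ≤ ε ^ 2 * ((2 / γ) ^ 2 + 4) := by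
          apply mul_le_mul e2 (by linarith) e6 (by positivity)
      _ ≤ r0 ^ 2 := e5
  set Q : ℝ → ℝ := fun u => u - γ / 2 * (1 - γ / 2 * u) ^ 2 with hQ
  have hQC : ContDiff ℝ (⊤ : ℕ∞) Q := by
    have : ContDiff ℝ (⊤ : ℕ∞) fun u : ℝ => 1 - γ / 2 * u :=
      contDiff_const.sub (contDiff_const.mul contDiff_id)
    exact contDiff_id.sub (contDiff_const.mul (this.pow 2))
  have hQd : ∀ u, HasDerivAt Q (1 + γ ^ 2 / 2 * (1 - γ / 2 * u)) u := by
    intro u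
    have e : HasDerivAt (fun u : ℝ => 1 - γ / 2 * u) (-(γ / 2)) u := by
      simpa using ((hasDerivAt_id u).const_mul (γ / 2)).const_sub 1
    have := (hasDerivAt_id u).sub ((e.pow 2).const_mul (γ / 2))
    refine this.congr_deriv ?_
    simp; ring
  -- monotonicity
  have hmono : ∀ τ, StrictMono fun u => F (τ, u) := by
    intro τ
    refine strictMono_of_deriv_pos fun u => ?_
    obtain ⟨k, hk, hd⟩ := hFd (τ, u)
    have h1 : HasDerivAt (fun u => (τ, u)) ((0:ℝ), (1:ℝ)) u :=
      (hasDerivAt_const _ _).prodMk (hasDerivAt_id u)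
    have h2 : HasDerivAt (fun u => F (τ, u)) _ u := HasFDerivAt.comp_hasDerivAt (l := F) u hd h1
    rw [h2.deriv]
    simpa using hk
  have hpd : ∀ u τ, ∃ k, 0 < k ∧ deriv (fun τ => F (τ, u)) τ = -g (τ, u) * k := by
    intro u τ
    obtain ⟨k, hk, hd⟩ := hFd (τ, u)
    have h1 : HasDerivAt (fun τ => (τ, u)) ((1:ℝ), (0:ℝ)) τ :=
      (hasDerivAt_id τ).prodMk (hasDerivAt_const _ _)
    have h2 : HasDerivAt (fun τ => F (τ, u)) _ τ := HasFDerivAt.comp_hasDerivAt (l := F) τ hd h1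
    refine ⟨k, hk, ?_⟩
    rw [h2.deriv]
    simp
  have hpmono : StrictMono fun τ => F (τ, up) := by
    refine strictMono_of_deriv_pos fun τ => ?_
    obtain ⟨k, hk, h⟩ := hpd up τ
    rw [h]
    have := hgup τ
    nlinarith
  have hpanti : StrictAnti fun τ => F (τ, um) := by
    refine strictAnti_of_deriv_neg fun τ => ?_
    obtain ⟨k, hk, h⟩ := hpd um τ
    rw [h]
    have := hgum τ
    nlinarith
  have hinv : ∀ τ σ u, τ ≤ σ → u ∈ Icc um up → G (σ, F (τ, u)) ∈ Icc um up := by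
    intro τ σ u hts hu
    constructor
    · rw [← (hmono σ).le_iff_le]
      simp only [hFG]
      exact (hpanti.antitone hts).trans ((hmono τ).monotone hu.1)
    · rw [← (hmono σ).le_iff_le]
      simp only [hFG]
      exact ((hmono τ).monotone hu.2).trans (hpmono.monotone hts)
  have hlin : ∀ τ ≤ 0, ∀ u ∈ Icc um up, Q (F (τ, u)) = Real.exp (2 * τ) * Q u := by
    intro τ hτ u hu
    set c := F (τ, u) with hc
    have hder : ∀ s ∈ Icc τ 0, HasDerivAt (fun s => Real.exp (2 * s) * Q (G (s, c))) 0 s := by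
      intro s hs
      have hin := hinv τ s u hs.1 hu
      rw [← hc] at hin
      obtain ⟨D, hD, hDe, hge⟩ := hgd s _ hin
      obtain ⟨e1, e2⟩ := hphi s hs.2 _ hin
      rw [e1, e2] at hDe
      rw [e1] at hge
      have d1 : HasDerivAt (fun s => Q (G (s, c)))
        ((1 + γ ^ 2 / 2 * (1 - γ / 2 * G (s, c))) * g (s, G (s, c))) s :=
        HasDerivAt.comp (h₂ := Q) s (hQd _) (hGd s c)
      have d2 := (((hasDerivAt_id s).const_mul 2).exp).mul d1
      refine d2.congr_deriv ?_
      rw [hge]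
      have hDe' : D = 1 + γ ^ 2 / 2 * (1 - γ / 2 * G (s, c)) := by rw [hDe]; ring
      rw [← hDe']
      simp only [id, hQ]
      field_simp
      rw [hDe']
      ring
    have := constant_of_derivWithin_zero (f := fun s => Real.exp (2 * s) * Q (G (s, c)))
      (a := τ) (b := 0) (fun s hs => (hder s hs).differentiableAt.differentiableWithinAt)
      (fun s hs => (hder s ⟨hs.1, hs.2.le⟩).hasDerivWithinAt.derivWithin
        (uniqueDiffOn_Icc (lt_of_le_of_lt hs.1 hs.2) s ⟨hs.1, hs.2.le⟩)) 0 ⟨hτ, le_rfl⟩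
    simp only [mul_zero, Real.exp_zero, one_mul, hG0] at this
    rw [this, hc, hGF]
  obtain ⟨ψ, hψ1, hψ2, hψ3, hψ4⟩ := core_psi hlt hF hF0 hFd hgup hgum hQC
    (fun c hc => by
      rw [(hQd c).deriv]
      have := (hub c ⟨hc.1.le, hc.2.le⟩).1
      positivity)
    (by
      have e2 : 1 - γ / 2 * up = 2 / (2 + γ ^ 2) := by rw [hup]; field_simp; ring
      simp only [hQ]
      rw [e2, hup]
      have : 2 * γ / (2 + γ ^ 2) - γ / 2 * (2 / (2 + γ ^ 2)) ^ 2 =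
        2 * γ * (1 + γ ^ 2) / (2 + γ ^ 2) ^ 2 := by field_simp; ring
      rw [this]
      positivity)
    (by simp only [hQ]; nlinarith [sq_nonneg (1 - γ / 2 * um)]) hlin
  -- geometry
  have hgeo : ∀ z : ℝ × ℝ, 0 ≤ γ * z.2 - z.1 → 0 ≤ z.2 + γ * z.1 → z ≠ 0 →
      0 < z.2 + γ / 2 * z.1 ∧ z.1 / (z.2 + γ / 2 * z.1) ∈ Icc um up := by
    rintro ⟨x, y⟩ hX hY hne
    simp only at hX hY ⊢
    have hl : 0 < y + γ / 2 * x := by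
      rcases lt_trichotomy x 0 with hx | hx | hx
      · nlinarith
      · subst hx
        have : y ≠ 0 := by rintro rfl; exact hne rfl
        have : 0 ≤ y := by linarith
        simp only [mul_zero, add_zero]
        exact lt_of_le_of_ne this (Ne.symm ‹_›)
      · have : 0 < y := by
          by_contra h
          nlinarith
        positivity
    refine ⟨hl, ?_, ?_⟩
    · rw [hum, div_le_div_iff₀ hγ hl]; nlinarith
    · rw [hup, div_le_div_iff₀ hl (by positivity)]; nlinarith
  set τf : ℝ × ℝ → ℝ := fun z => Real.log ((z.2 + γ / 2 * z.1) / ε) with hτf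
  set uf : ℝ × ℝ → ℝ := fun z => z.1 / (z.2 + γ / 2 * z.1) with huf
  have hchart : ∀ z : ℝ × ℝ, 0 < z.2 + γ / 2 * z.1 →
      ε * Real.exp (τf z) * uf z = z.1 ∧ ε * Real.exp (τf z) * (1 - γ / 2 * uf z) = z.2 ∧
      ε * Real.exp (τf z) = z.2 + γ / 2 * z.1 := by
    intro z hz
    have e : ε * Real.exp (τf z) = z.2 + γ / 2 * z.1 := by
      rw [hτf]; simp only
      rw [Real.exp_log (by positivity)]
      field_simp
    rw [e]
    refine ⟨?_, ?_, rfl⟩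
    · exact mul_div_cancel₀ _ hz.ne'
    · have e3 : (z.2 + γ / 2 * z.1) * uf z = z.1 := mul_div_cancel₀ _ hz.ne'
      linear_combination -(γ / 2) * e3
  have hval : ∀ z : ℝ × ℝ, 0 < z.2 + γ / 2 * z.1 →
      ε ^ 2 * (Real.exp (2 * τf z) * Q (uf z)) =
        γ / 2 * z.1 ^ 2 + z.1 * z.2 - γ / 2 * z.2 ^ 2 := by
    intro z hz
    obtain ⟨c1, c2, c3⟩ := hchart z hz
    have : Real.exp (2 * τf z) = Real.exp (τf z) ^ 2 := by
      rw [two_mul, Real.exp_add]; ring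
    rw [this]
    calc _ = (ε * Real.exp (τf z) * uf z) * (ε * Real.exp (τf z)) -
          γ / 2 * (ε * Real.exp (τf z) * (1 - γ / 2 * uf z)) ^ 2 := by
            simp only [hQ]; ring
      _ = _ := by rw [c1, c2, c3]; ring
  refine ⟨fun z => ε ^ 2 * ψ (F (τf z, uf z)), ε / (1 + γ), by positivity, ?_, ?_⟩
  · intro z hX hY hne
    obtain ⟨hl, hu⟩ := hgeo z hX hY hne
    have hcl : ContDiff ℝ (⊤ : ℕ∞) fun z : ℝ × ℝ => z.2 + γ / 2 * z.1 :=
      contDiff_snd.add (contDiff_const.mul contDiff_fst)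
    have hτC : ContDiffAt ℝ (⊤ : ℕ∞) τf z :=
      (hcl.contDiffAt.div_const ε).log (by positivity)
    have huC : ContDiffAt ℝ (⊤ : ℕ∞) uf z := contDiffAt_fst.div hcl.contDiffAt hl.ne'
    have hpC : ContDiffAt ℝ (⊤ : ℕ∞) (fun z => (τf z, uf z)) z := hτC.prodMk huC
    have hFC : ContDiffAt ℝ (⊤ : ℕ∞) (fun z => F (τf z, uf z)) z := hF.contDiffAt.comp z hpC
    obtain ⟨k1, k2⟩ := hψ1 (τf z) (uf z) hu
    refine ⟨contDiffAt_const.mul (ContDiffAt.comp (g := ψ) z k1 hFC), ?_⟩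
    filter_upwards [hpC.continuousAt.eventually (hgs (τf z) (uf z) hu),
      hFC.continuousAt.eventually k2, hcl.continuous.continuousAt.eventually (lt_mem_nhds hl)]
      with w hw1 hw2 hw3
    obtain ⟨D, hD, hDe, hge⟩ := hw1
    obtain ⟨m, hm, hmd⟩ := hw2
    obtain ⟨k, hk, hkd⟩ := hFd (τf w, uf w)
    obtain ⟨c1, c2, c3⟩ := hchart w hw3
    simp only [c1, c2] at hDe hge
    set l := w.2 + γ / 2 * w.1 with hlw
    have hld : HasFDerivAt (fun z : ℝ × ℝ => z.2 + γ / 2 * z.1)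
        (ContinuousLinearMap.snd ℝ ℝ ℝ + (γ / 2) • ContinuousLinearMap.fst ℝ ℝ ℝ) w :=
      hasFDerivAt_snd.add (hasFDerivAt_fst.const_mul (γ / 2))
    have hτd : HasFDerivAt τf ((1 / l) •
        (ContinuousLinearMap.snd ℝ ℝ ℝ + (γ / 2) • ContinuousLinearMap.fst ℝ ℝ ℝ)) w := by
      have e1 : HasDerivAt (fun t : ℝ => Real.log (t / ε)) (1 / l) l := by
        have := ((hasDerivAt_id l).div_const ε).log (by simp; exact ⟨hw3.ne', hε0.ne'⟩)
        refine this.congr_deriv ?_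
        simp only [id]
        field_simp
      exact e1.comp_hasFDerivAt w hld
    have hud : HasFDerivAt uf (((1 - γ / 2 * uf w) / l) • ContinuousLinearMap.fst ℝ ℝ ℝ +
        (-(uf w / l)) • ContinuousLinearMap.snd ℝ ℝ ℝ) w := by
      have e1 := (hasFDerivAt_fst (𝕜 := ℝ) (p := w)).mul
        ((hasDerivAt_inv hw3.ne').comp_hasFDerivAt w hld)
      have e2 : uf = fun z => z.1 * (Inv.inv ∘ fun z : ℝ × ℝ => z.2 + γ / 2 * z.1) z := by
        funext z; simp [huf, div_eq_mul_inv]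
      rw [e2]
      refine e1.congr_fderiv ?_
      have hl0 : w.2 + γ / 2 * w.1 ≠ 0 := hw3.ne'
      ext
      · simp
        rw [← hlw]
        field_simp
        ring
      · simp
        rw [← hlw]
        field_simp
    have hcomp := (hmd.comp_hasFDerivAt w (hkd.comp w (hτd.prodMk hud))).const_mul (ε ^ 2)
    refine ⟨ε ^ 2 * m * k / (l ^ 2 * D), by positivity, ?_⟩
    have hX : γ * w.2 - w.1 = l * (γ - (γ ^ 2 / 2 + 1) * uf w) := by
      rw [← c3]
      linear_combination -γ * c2 + c1
    have hY : w.2 + γ * w.1 = l * (1 + γ / 2 * uf w) := by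
      rw [← c3]
      linear_combination - c2 - γ * c1
    refine hcomp.congr_fderiv ?_
    rw [hX, hY, hge]
    generalize uf w = u at *
    generalize φ1 w = a at *
    generalize φ2 w = b at *
    have hl0 : l ≠ 0 := hw3.ne'
    clear_value l
    have hD0 := hD.ne'
    apply ContinuousLinearMap.ext
    intro q
    simp
    field_simp
    rw [hDe]
    ring
  · intro z hX hY hne hcase
    obtain ⟨hl, hu⟩ := hgeo z hX hY hne
    simp only
    rw [← hval z hl]
    congr 1
    rcases hcase with h | h | h
    · have : uf z = up := by
        simp only [huf, hup]
        rw [div_eq_div_iff hl.ne' (by positivity)]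
        have : z.1 = γ * z.2 := by linarith
        rw [this]; ring
      rw [this]; exact hψ2 _
    · have : uf z = um := by
        simp only [huf, hum]
        rw [div_eq_div_iff hl.ne' hγ.ne']
        have : z.2 = -(γ * z.1) := by linarith
        rw [this]; ring
      rw [this]; exact hψ3 _
    · refine hψ4 _ ?_ _ hu
      apply Real.log_neg (by positivity)
      rw [div_lt_one hε0]
      have a1 : |z.1| < ε / (1 + γ) := abs_lt_of_sq_lt_sq (by nlinarith [sq_nonneg z.2]) (by positivity)
      have a2 : |z.2| < ε / (1 + γ) := abs_lt_of_sq_lt_sq (by nlinarith [sq_nonneg z.1]) (by positivity)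
      have a3 := (abs_lt.1 a1).2
      have a4 := (abs_lt.1 a2).2
      have a5 : ε = ε / (1 + γ) + γ * (ε / (1 + γ)) := by field_simp
      have a6 : 0 < ε / (1 + γ) := by positivity
      rw [a5]
      nlinarith

lemma aux_equiv (γ A B : ℝ) (h : γ * A + B ≠ 0) : ∃ E : (ℝ × ℝ) ≃L[ℝ] (ℝ × ℝ),
    ∀ q : ℝ × ℝ, E q = (γ * q.2 - q.1, A * q.1 + B * q.2) := by
  obtain ⟨e, he⟩ : ∃ e, e = γ * A + B := ⟨_, rfl⟩
  obtain rfl : B = e - γ * A := by linarith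
  rw [← he] at h
  refine ⟨ContinuousLinearEquiv.equivOfInverse
    ((γ • ContinuousLinearMap.snd ℝ ℝ ℝ - ContinuousLinearMap.fst ℝ ℝ ℝ).prod
      (A • ContinuousLinearMap.fst ℝ ℝ ℝ + (e - γ * A) • ContinuousLinearMap.snd ℝ ℝ ℝ))
    (((-(e - γ * A) / e) • ContinuousLinearMap.fst ℝ ℝ ℝ +
        (γ / e) • ContinuousLinearMap.snd ℝ ℝ ℝ).prod
      ((A / e) • ContinuousLinearMap.fst ℝ ℝ ℝ +
        (1 / e) • ContinuousLinearMap.snd ℝ ℝ ℝ)) ?_ ?_, ?_⟩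
  · intro q
    ext <;> simp <;> field_simp <;> ring
  · intro q
    ext <;> simp <;> field_simp <;> ring
  · intro q
    simp

lemma local_unique {γ : ℝ} {f d : ℝ × ℝ → ℝ} {z0 : ℝ × ℝ}
    (hf : ContDiffAt ℝ (⊤ : ℕ∞) f z0) (hX0 : γ * z0.2 - z0.1 = 0)
    (ht : fderiv ℝ f z0 (γ, 1) ≠ 0)
    (hd : ∀ᶠ z in 𝓝 z0, ∃ l : ℝ, HasFDerivAt d (l • fderiv ℝ f z) z)
    (h0 : ∀ᶠ z : ℝ × ℝ in 𝓝 z0, γ * z.2 - z.1 = 0 → d z = 0) :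
    ∀ᶠ z in 𝓝 z0, d z = 0 := by
  set Φ : ℝ × ℝ → ℝ × ℝ := fun z => (γ * z.2 - z.1, f z) with hΦ
  have hΦs : ContDiffAt ℝ (⊤ : ℕ∞) Φ z0 :=
    ((contDiffAt_const.mul contDiffAt_snd).sub contDiffAt_fst).prodMk hf
  have hfd : HasFDerivAt f (fderiv ℝ f z0) z0 := (hf.differentiableAt (by simp)).hasFDerivAt
  set A := fderiv ℝ f z0 (1, 0) with hA
  set B := fderiv ℝ f z0 (0, 1) with hB
  have hlin : ∀ q : ℝ × ℝ, fderiv ℝ f z0 q = A * q.1 + B * q.2 := by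
    intro q
    have : q = q.1 • ((1:ℝ), (0:ℝ)) + q.2 • ((0:ℝ), (1:ℝ)) := by ext <;> simp
    conv_lhs => rw [this]
    rw [map_add, map_smul, map_smul, smul_eq_mul, smul_eq_mul, ← hA, ← hB]
    ring
  have hAB : γ * A + B ≠ 0 := by
    rw [hlin] at ht
    intro h
    apply ht
    simp only
    linarith
  obtain ⟨L, hL⟩ := aux_equiv γ A B hAB
  have hΦd : HasFDerivAt Φ (L : (ℝ × ℝ) →L[ℝ] (ℝ × ℝ)) z0 := by
    refine (((hasFDerivAt_snd.const_mul γ).sub hasFDerivAt_fst).prodMk hfd).congr_fderiv ?_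
    apply ContinuousLinearMap.ext
    intro q
    simp [hL, hlin]
  set Ψ := hΦs.localInverse hΦd (by simp) with hΨ
  have hloc : ContDiffAt ℝ (⊤ : ℕ∞) Ψ (Φ z0) := hΦs.to_localInverse hΦd (by simp)
  have hst := hΦs.hasStrictFDerivAt' hΦd (by simp)
  have hright : ∀ᶠ w in 𝓝 (Φ z0), Φ (Ψ w) = w := hst.eventually_right_inverse
  have hleft : ∀ᶠ z in 𝓝 z0, Ψ (Φ z) = z := hst.eventually_left_inverse
  have hΨ0 : Ψ (Φ z0) = z0 := hleft.self_of_nhds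
  have hΨt : Tendsto Ψ (𝓝 (Φ z0)) (𝓝 z0) := by
    have := hloc.continuousAt.tendsto
    rwa [hΨ0] at this
  have hΨdiff : ∀ᶠ w in 𝓝 (Φ z0), DifferentiableAt ℝ Ψ w := by
    have := (hloc.of_le (m := 1) (by simp)).eventually (by simp)
    filter_upwards [this] with w hw using hw.differentiableAt (by simp)
  have hfdiff : ∀ᶠ z in 𝓝 z0, DifferentiableAt ℝ f z := by
    have := (hf.of_le (m := 1) (by simp)).eventually (by simp)
    filter_upwards [this] with w hw using hw.differentiableAt (by simp)
  have hall := (((hΨdiff.and hright.eventually_nhds).and (hΨt.eventually hfdiff)).and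
    (hΨt.eventually hd)).and (hΨt.eventually h0)
  obtain ⟨δ, hδ, hball⟩ := Metric.eventually_nhds_iff.1 hall
  have hΦz0 : Φ z0 = (0, f z0) := by simp [hΦ, hX0]
  have hin : ∀ s c : ℝ, |s| < δ → |c - f z0| < δ → dist (s, c) (Φ z0) < δ := by
    intro s c hs hc
    rw [hΦz0, Prod.dist_eq]
    simp only [Real.dist_eq, sub_zero]
    exact max_lt hs hc
  have hzero : ∀ s c : ℝ, |s| < δ → |c - f z0| < δ → d (Ψ (s, c)) = 0 := by
    intro s c hs hc
    have hder : ∀ t ∈ Ioo (-δ) δ, HasDerivAt (fun t => d (Ψ (t, c))) 0 t := by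
      intro t ht
      obtain ⟨⟨⟨⟨b1, b2⟩, b3⟩, ⟨l, b4⟩⟩, b5⟩ := hball (hin t c (abs_lt.2 ht) hc)
      have e1 : HasDerivAt (fun t => (t, c)) ((1:ℝ), (0:ℝ)) t :=
        (hasDerivAt_id t).prodMk (hasDerivAt_const _ _)
      have e2 : HasDerivAt (fun t => Ψ (t, c)) _ t :=
        HasFDerivAt.comp_hasDerivAt (l := Ψ) t b1.hasFDerivAt e1
      have e3 : HasDerivAt (fun t => f (Ψ (t, c))) _ t :=
        HasFDerivAt.comp_hasDerivAt (l := f) t b3.hasFDerivAt e2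
      have e4 : HasDerivAt (fun t => d (Ψ (t, c))) _ t :=
        HasFDerivAt.comp_hasDerivAt (l := d) t b4 e2
      have e5 : (fun t => f (Ψ (t, c))) =ᶠ[𝓝 t] fun _ => c := by
        have : Continuous fun t : ℝ => (t, c) := by fun_prop
        filter_upwards [this.continuousAt.eventually b2] with t' ht'
        exact congrArg Prod.snd ht'
      have e6 := e3.unique ((hasDerivAt_const t c).congr_of_eventuallyEq e5)
      refine e4.congr_deriv ?_
      simp only [smul_apply]
      rw [e6, smul_zero]
    have h1 := Convex.norm_image_sub_le_of_norm_hasDerivWithin_le (s := Ioo (-δ) δ)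
      (f := fun t => d (Ψ (t, c))) (f' := fun _ => 0) (C := 0) (x := 0) (y := s)
      (fun t ht => (hder t ht).hasDerivWithinAt) (fun t _ => by simp) (convex_Ioo _ _)
      ⟨by linarith, hδ⟩ (abs_lt.1 hs)
    have h2 : d (Ψ (0, c)) = 0 := by
      obtain ⟨⟨⟨⟨b1, b2⟩, b3⟩, b4⟩, b5⟩ := hball (hin 0 c (by simpa using hδ) hc)
      exact b5 (congrArg Prod.fst b2.self_of_nhds)
    rw [h2] at h1
    simpa using h1
  have hΦc : ContinuousAt Φ z0 := hΦs.continuousAt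
  have hnear : ∀ᶠ z in 𝓝 z0, dist (Φ z) (Φ z0) < δ :=
    hΦc.eventually (Metric.ball_mem_nhds _ hδ)
  filter_upwards [hnear, hleft] with z hz1 hz2
  rw [← hz2]
  rw [hΦz0, Prod.dist_eq] at hz1
  have h1 := lt_of_le_of_lt (le_max_left _ _) hz1
  have h2 := lt_of_le_of_lt (le_max_right _ _) hz1
  simp only [Real.dist_eq, sub_zero] at h1 h2
  exact hzero _ _ h1 h2

lemma glue_def {γ : ℝ} (hγ : 0 < γ) {f1 : ℝ × ℝ → ℝ}
    (hedge : ∀ z : ℝ × ℝ, 0 ≤ γ * z.2 - z.1 → 0 ≤ z.2 + γ * z.1 → z ≠ 0 →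
        (γ * z.2 - z.1 = 0 ∨ z.2 + γ * z.1 = 0) →
        f1 z = γ / 2 * z.1 ^ 2 + z.1 * z.2 - γ / 2 * z.2 ^ 2) :
    ∃ f : ℝ × ℝ → ℝ, (∀ z : ℝ × ℝ, z ≠ 0 → 0 ≤ γ * z.2 - z.1 → 0 ≤ z.2 + γ * z.1 → f z = f1 z) ∧
      ∀ x y, f (-y, x) = - f (x, y) := by
  have hz : ∀ x y : ℝ, γ * y - x = 0 → y + γ * x = 0 → x = 0 ∧ y = 0 := by
    intro x y h1 h2
    have h3 : x = γ * y := by linarith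
    have h4 : y * (1 + γ ^ 2) = 0 := by rw [h3] at h2; linarith
    have h5 : y = 0 := by
      rcases mul_eq_zero.1 h4 with h | h
      · exact h
      · nlinarith [sq_nonneg γ]
    exact ⟨by rw [h3, h5, mul_zero], h5⟩
  classical
  set f : ℝ × ℝ → ℝ := fun z => if z = 0 then 0 else
    if 0 ≤ γ * z.2 - z.1 ∧ 0 ≤ z.2 + γ * z.1 then f1 z else
    if γ * z.2 - z.1 ≤ 0 ∧ 0 ≤ z.2 + γ * z.1 then - f1 (-z.2, z.1) else
    if γ * z.2 - z.1 ≤ 0 ∧ z.2 + γ * z.1 ≤ 0 then f1 (-z.1, -z.2) else - f1 (z.2, -z.1) with hf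
  have f00 : f 0 = 0 := by simp [hf]
  have E : ∀ x y : ℝ, (x, y) ≠ (0 : ℝ × ℝ) → 0 ≤ γ * y - x → 0 ≤ y + γ * x →
      (γ * y - x = 0 ∨ y + γ * x = 0) → f1 (x, y) = γ / 2 * x ^ 2 + x * y - γ / 2 * y ^ 2 :=
    fun x y h1 h2 h3 h4 => hedge (x, y) h2 h3 h1 h4
  have ne1 : ∀ x y : ℝ, (x, y) ≠ (0 : ℝ × ℝ) → (-y, x) ≠ (0 : ℝ × ℝ) := by
    intro x y h h'
    obtain ⟨a, b⟩ := Prod.mk_eq_zero.1 h'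
    exact h (Prod.mk_eq_zero.2 ⟨b, neg_eq_zero.1 a⟩)
  have A1 : ∀ x y : ℝ, (x, y) ≠ (0 : ℝ × ℝ) → 0 ≤ γ * y - x → 0 ≤ y + γ * x →
      f (x, y) = f1 (x, y) := by
    intro x y h1 h2 h3
    simp only [hf]
    rw [if_neg h1, if_pos ⟨h2, h3⟩]
  have A2 : ∀ x y : ℝ, (x, y) ≠ (0 : ℝ × ℝ) → γ * y - x ≤ 0 → 0 ≤ y + γ * x →
      f (x, y) = - f1 (-y, x) := by
    intro x y h1 h2 h3
    simp only [hf]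
    rw [if_neg h1]
    split_ifs with c1
    · have e : γ * y - x = 0 := le_antisymm h2 c1.1
      rw [E x y h1 c1.1 c1.2 (Or.inl e),
        E (-y) x (ne1 _ _ h1) (by linarith) (by linarith) (Or.inr (by linarith))]
      ring
    · rfl
    · tauto
    · tauto
  have A3 : ∀ x y : ℝ, (x, y) ≠ (0 : ℝ × ℝ) → γ * y - x ≤ 0 → y + γ * x ≤ 0 →
      f (x, y) = f1 (-x, -y) := by
    intro x y h1 h2 h3
    simp only [hf]
    rw [if_neg h1]
    split_ifs with c1 c2
    · obtain ⟨rfl, rfl⟩ := hz x y (le_antisymm h2 c1.1) (le_antisymm h3 c1.2)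
      exact absurd rfl h1
    · have e : y + γ * x = 0 := le_antisymm h3 c2.2
      rw [E (-y) x (ne1 _ _ h1) (by linarith) (by linarith) (Or.inl (by linarith)),
        E (-x) (-y) (ne1 _ _ (ne1 _ _ h1)) (by linarith) (by linarith) (Or.inr (by linarith))]
      ring
    · rfl
    · tauto
  have A4 : ∀ x y : ℝ, (x, y) ≠ (0 : ℝ × ℝ) → 0 ≤ γ * y - x → y + γ * x ≤ 0 →
      f (x, y) = - f1 (y, -x) := by
    intro x y h1 h2 h3
    have ne3 : (y, -x) ≠ (0 : ℝ × ℝ) := by simpa using ne1 _ _ (ne1 _ _ (ne1 _ _ h1))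
    simp only [hf]
    rw [if_neg h1]
    split_ifs with c1 c2 c3
    · have e : y + γ * x = 0 := le_antisymm h3 c1.2
      rw [E x y h1 c1.1 c1.2 (Or.inr e),
        E y (-x) ne3 (by linarith) (by linarith) (Or.inl (by linarith))]
      ring
    · obtain ⟨rfl, rfl⟩ := hz x y (le_antisymm c2.1 h2) (le_antisymm h3 c2.2)
      exact absurd rfl h1
    · have e : γ * y - x = 0 := le_antisymm c3.1 h2
      rw [E (-x) (-y) (ne1 _ _ (ne1 _ _ h1)) (by linarith) (by linarith) (Or.inl (by linarith)),
        E y (-x) ne3 (by linarith) (by linarith) (Or.inr (by linarith))]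
      ring
    · rfl
  refine ⟨f, fun z h1 h2 h3 => A1 z.1 z.2 h1 h2 h3, fun x y => ?_⟩
  by_cases h0 : (x, y) = (0 : ℝ × ℝ)
  · obtain ⟨rfl, rfl⟩ := Prod.mk_eq_zero.1 h0
    have : f (0, 0) = 0 := f00
    simp [this]
  have n := ne1 _ _ h0
  rcases le_total 0 (γ * y - x) with hX | hX <;> rcases le_total 0 (y + γ * x) with hY | hY
  · rw [A1 x y h0 hX hY, A4 (-y) x n (by linarith) (by linarith)]
    simp
  · rw [A4 x y h0 hX hY, A3 (-y) x n (by linarith) (by linarith)]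
    simp
  · rw [A2 x y h0 hX hY, A1 (-y) x n (by linarith) (by linarith)]
    simp
  · rw [A3 x y h0 hX hY, A2 (-y) x n (by linarith) (by linarith)]

lemma glue {γ r0 : ℝ} (hγ : 0 < γ) (hr0 : 0 < r0) {φ1 φ2 : ℝ × ℝ → ℝ}
    (h1 : ContDiff ℝ (⊤ : ℕ∞) φ1) (h2 : ContDiff ℝ (⊤ : ℕ∞) φ2)
    (p1 : ∀ p, 0 < φ1 p) (p2 : ∀ p, 0 < φ2 p)
    (hlow : ∀ p : ℝ × ℝ, p.1 ^ 2 + p.2 ^ 2 ≤ r0 ^ 2 → φ1 p = 1 ∧ φ2 p = 1)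
    (s1 : ∀ x y, φ1 (-y, x) = φ2 (x, y)) (s2 : ∀ x y, φ2 (-y, x) = φ1 (x, y)) :
    ∃ (f : ℝ × ℝ → ℝ) (r : ℝ), 0 < r ∧
      (∀ z : ℝ × ℝ, z ≠ 0 →
        ContDiffAt ℝ (⊤ : ℕ∞) f z ∧ ∃ μ, 0 < μ ∧
          HasFDerivAt f ((μ * ((z.2 + γ * z.1) * φ2 z)) • ContinuousLinearMap.fst ℝ ℝ ℝ +
            (-(μ * ((γ * z.2 - z.1) * φ1 z))) • ContinuousLinearMap.snd ℝ ℝ ℝ) z) ∧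
      (∀ z : ℝ × ℝ, z.1 ^ 2 + z.2 ^ 2 < r ^ 2 →
        f z = γ / 2 * z.1 ^ 2 + z.1 * z.2 - γ / 2 * z.2 ^ 2) := by
  obtain ⟨f1, r, hr, H1, H2⟩ := core hγ hr0 h1 h2 p1 p2 hlow
  obtain ⟨f, hf1, hfJ⟩ := glue_def hγ (f1 := f1) (fun z a b c d => H2 z a b c (by tauto))
  have hJC : ContDiff ℝ (⊤ : ℕ∞) fun z : ℝ × ℝ => (-z.2, z.1) := contDiff_snd.neg.prodMk contDiff_fst
  have hJd : ∀ z : ℝ × ℝ, HasFDerivAt (fun z : ℝ × ℝ => (-z.2, z.1))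
      ((-ContinuousLinearMap.snd ℝ ℝ ℝ).prod (ContinuousLinearMap.fst ℝ ℝ ℝ)) z :=
    fun z => hasFDerivAt_snd.neg.prodMk hasFDerivAt_fst
  have ne1 : ∀ x y : ℝ, (x, y) ≠ (0 : ℝ × ℝ) → (-y, x) ≠ (0 : ℝ × ℝ) := by
    intro x y h h'
    obtain ⟨a, b⟩ := Prod.mk_eq_zero.1 h'
    exact h (Prod.mk_eq_zero.2 ⟨b, neg_eq_zero.1 a⟩)
  -- derivative transfer
  have tr : ∀ (h : ℝ × ℝ → ℝ) (x y μ : ℝ), HasFDerivAt h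
      ((μ * ((x + γ * (-y)) * φ2 (-y, x))) • ContinuousLinearMap.fst ℝ ℝ ℝ +
        (-(μ * ((γ * x - (-y)) * φ1 (-y, x)))) • ContinuousLinearMap.snd ℝ ℝ ℝ) (-y, x) →
      HasFDerivAt (fun z : ℝ × ℝ => - h (-z.2, z.1))
        ((μ * ((y + γ * x) * φ2 (x, y))) • ContinuousLinearMap.fst ℝ ℝ ℝ +
        (-(μ * ((γ * y - x) * φ1 (x, y)))) • ContinuousLinearMap.snd ℝ ℝ ℝ) (x, y) := by
    intro h x y μ hh
    have := (HasFDerivAt.comp (g := h) (x, y) hh (hJd (x, y))).neg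
    refine this.congr_fderiv ?_
    rw [s1, s2]
    apply ContinuousLinearMap.ext
    intro q
    simp
    ring
  -- local equality
  have loc : ∀ x y : ℝ, 0 ≤ γ * y - x → 0 < y + γ * x → f =ᶠ[𝓝 (x, y)] f1 := by
    intro x y hX hY
    have hne : (x, y) ≠ (0 : ℝ × ℝ) := by
      intro h
      obtain ⟨rfl, rfl⟩ := Prod.mk_eq_zero.1 h
      simp at hY
    have ev0 : ∀ᶠ w : ℝ × ℝ in 𝓝 (x, y), w ≠ 0 := isOpen_ne.mem_nhds hne
    have evY : ∀ᶠ w : ℝ × ℝ in 𝓝 (x, y), 0 < w.2 + γ * w.1 := by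
      have : Continuous fun w : ℝ × ℝ => w.2 + γ * w.1 := by fun_prop
      exact this.continuousAt.eventually (lt_mem_nhds hY)
    rcases hX.lt_or_eq with hX' | hX'
    · have evX : ∀ᶠ w : ℝ × ℝ in 𝓝 (x, y), 0 < γ * w.2 - w.1 := by
        have : Continuous fun w : ℝ × ℝ => γ * w.2 - w.1 := by fun_prop
        exact this.continuousAt.eventually (lt_mem_nhds hX')
      filter_upwards [ev0, evX, evY] with w a b c using hf1 w a b.le c.le
    · obtain ⟨k1, k2⟩ := H1 (x, y) hX hY.le hne
      obtain ⟨-, k4⟩ := H1 (-y, x) (by simp only; linarith) (by simp only; linarith) (ne1 _ _ hne)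
      have k4' := (hJC.continuous.continuousAt (x := (x, y))).eventually k4
      have hd := local_unique (γ := γ) (f := f1) (d := fun w => - f1 (-w.2, w.1) - f1 w)
        (z0 := (x, y)) k1 hX'.symm
        (by
          obtain ⟨μ, hμ, hh⟩ := k2.self_of_nhds
          rw [hh.fderiv]
          simp only [← hX']
          have := p2 (x, y)
          have : 0 < μ * ((y + γ * x) * φ2 (x, y)) * γ := by positivity
          simpa using this.ne')
        (by
          filter_upwards [k2, k4'] with w w1 w2
          obtain ⟨μ, hμ, hh⟩ := w1
          obtain ⟨ν, hν, hh2⟩ := w2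
          refine ⟨ν / μ - 1, ?_⟩
          have := (tr f1 w.1 w.2 ν hh2).sub hh
          refine this.congr_fderiv ?_
          rw [hh.fderiv]
          apply ContinuousLinearMap.ext
          intro q
          simp
          field_simp)
        (by
          filter_upwards [ev0, evY] with w a b c
          rw [H2 w c.ge b.le a (Or.inl c), H2 (-w.2, w.1) (by simp only; linarith)
            (by simp only; linarith) (ne1 _ _ a) (Or.inr (Or.inl (by simp only; linarith)))]
          ring)
      filter_upwards [ev0, evY, hd] with w a b c
      rcases le_total 0 (γ * w.2 - w.1) with e | e
      · exact hf1 w a e b.le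
      · have e1 := hfJ w.1 w.2
        rw [hf1 (-w.2, w.1) (ne1 _ _ a) (by simp only; linarith) (by simp only; linarith)] at e1
        have : f w = - f1 (-w.2, w.1) := by linarith
        rw [this]; linarith
  have good1 : ∀ x y : ℝ, 0 ≤ γ * y - x → 0 < y + γ * x →
      ContDiffAt ℝ (⊤ : ℕ∞) f (x, y) ∧ ∃ μ, 0 < μ ∧
        HasFDerivAt f ((μ * ((y + γ * x) * φ2 (x, y))) • ContinuousLinearMap.fst ℝ ℝ ℝ +
            (-(μ * ((γ * y - x) * φ1 (x, y)))) • ContinuousLinearMap.snd ℝ ℝ ℝ) (x, y) := by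
    intro x y hX hY
    have hne : (x, y) ≠ (0 : ℝ × ℝ) := by
      intro h
      obtain ⟨rfl, rfl⟩ := Prod.mk_eq_zero.1 h
      simp at hY
    obtain ⟨k1, k2⟩ := H1 (x, y) hX hY.le hne
    obtain ⟨μ, hμ, hh⟩ := k2.self_of_nhds
    have := loc x y hX hY
    exact ⟨k1.congr_of_eventuallyEq this, μ, hμ, hh.congr_of_eventuallyEq this⟩
  have hfe : f = fun z : ℝ × ℝ => - f (-z.2, z.1) := by
    funext z
    have := hfJ z.1 z.2
    simp only [Prod.mk.eta] at this
    linarith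
  have goodJ : ∀ x y : ℝ, (ContDiffAt ℝ (⊤ : ℕ∞) f (-y, x) ∧ ∃ μ, 0 < μ ∧
        HasFDerivAt f ((μ * ((x + γ * (-y)) * φ2 (-y, x))) • ContinuousLinearMap.fst ℝ ℝ ℝ +
            (-(μ * ((γ * x - (-y)) * φ1 (-y, x)))) • ContinuousLinearMap.snd ℝ ℝ ℝ) (-y, x)) →
      ContDiffAt ℝ (⊤ : ℕ∞) f (x, y) ∧ ∃ μ, 0 < μ ∧
        HasFDerivAt f ((μ * ((y + γ * x) * φ2 (x, y))) • ContinuousLinearMap.fst ℝ ℝ ℝ +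
            (-(μ * ((γ * y - x) * φ1 (x, y)))) • ContinuousLinearMap.snd ℝ ℝ ℝ) (x, y) := by
    rintro x y ⟨a, μ, hμ, hh⟩
    refine ⟨?_, μ, hμ, ?_⟩
    · rw [hfe]
      exact (ContDiffAt.comp (g := f) (x, y) a hJC.contDiffAt).neg
    · have := tr f x y μ hh
      rwa [← hfe] at this
  refine ⟨f, r, hr, ?_, ?_⟩
  · rintro ⟨x, y⟩ hne
    simp only
    by_cases c1 : 0 ≤ γ * y - x ∧ 0 < y + γ * x
    · exact good1 x y c1.1 c1.2
    apply goodJ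
    by_cases c2 : γ * y - x < 0 ∧ 0 ≤ y + γ * x
    · exact good1 (-y) x (by linarith) (by linarith)
    apply goodJ
    by_cases c3 : γ * y - x ≤ 0 ∧ y + γ * x < 0
    · exact good1 (-x) (-y) (by linarith) (by linarith)
    apply goodJ
    have c4 : 0 < γ * y - x ∧ y + γ * x ≤ 0 := by
      rcases lt_trichotomy (γ * y - x) 0 with e | e | e
      · exfalso
        rcases le_or_gt 0 (y + γ * x) with e' | e'
        · exact c2 ⟨e, e'⟩
        · exact c3 ⟨e.le, e'⟩
      · exfalso
        rcases lt_trichotomy 0 (y + γ * x) with e' | e' | e'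
        · exact c1 ⟨e.ge, e'⟩
        · apply hne
          have h3 : x = γ * y := by linarith
          have h4 : y * (1 + γ ^ 2) = 0 := by rw [h3] at e'; linarith
          have h5 : y = 0 := by
            rcases mul_eq_zero.1 h4 with h | h
            · exact h
            · nlinarith [sq_nonneg γ]
          rw [h3, h5, mul_zero]; rfl
        · exact c3 ⟨e.le, e'⟩
      · refine ⟨e, ?_⟩
        by_contra h
        exact c1 ⟨e.le, not_le.1 h⟩
    have := good1 y (-x) (by linarith) (by linarith)
    simpa using this
  · have b1 : ∀ x y : ℝ, x ^ 2 + y ^ 2 < r ^ 2 → (x, y) ≠ (0 : ℝ × ℝ) → 0 ≤ γ * y - x →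
        0 ≤ y + γ * x → f (x, y) = γ / 2 * x ^ 2 + x * y - γ / 2 * y ^ 2 := by
      intro x y a b c d
      rw [hf1 _ b c d]
      exact H2 _ c d b (Or.inr (Or.inr a))
    rintro ⟨x, y⟩ hz
    simp only at hz ⊢
    have j1 := hfJ x y
    by_cases h0 : (x, y) = (0 : ℝ × ℝ)
    · obtain ⟨rfl, rfl⟩ := Prod.mk_eq_zero.1 h0
      rw [neg_zero] at j1
      have : f (0, 0) = 0 := by linarith
      rw [this]; ring
    have n1 := ne1 _ _ h0
    have n2 := ne1 _ _ n1
    have n3 := ne1 _ _ n2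
    have j2 := hfJ (-y) x
    have j3 := hfJ (-x) (-y)
    rcases le_total 0 (γ * y - x) with hX | hX <;> rcases le_total 0 (y + γ * x) with hY | hY
    · exact b1 x y hz h0 hX hY
    · have := b1 (- -y) (-x) (by nlinarith) n3 (by linarith) (by linarith)
      rw [this] at j3
      linarith
    · have := b1 (-y) x (by nlinarith) n1 (by linarith) (by linarith)
      rw [this] at j1
      linarith
    · have := b1 (-x) (-y) (by nlinarith) n2 (by linarith) (by linarith)
      rw [this] at j2
      linarith

lemma phi_comp {φ : ℝ → ℝ} (hs : ContDiffOn ℝ (⊤ : ℕ∞) φ (Ici 0))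
    (hlow : ∀ t ∈ Icc (0 : ℝ) (1 / 2), φ t = 1) {q : ℝ × ℝ → ℝ}
    (hq : ContDiff ℝ (⊤ : ℕ∞) q) (hq0 : ∀ p, 0 ≤ q p) :
    ContDiff ℝ (⊤ : ℕ∞) fun p => φ (q p) := by
  rw [contDiff_iff_contDiffAt]
  intro p
  rcases (hq0 p).lt_or_eq with h | h
  · exact ContDiffAt.comp (g := φ) p (hs.contDiffAt (Ici_mem_nhds h)) hq.contDiffAt
  · have : ∀ᶠ w in 𝓝 p, q w < 1 / 2 :=
      hq.continuous.continuousAt.eventually (gt_mem_nhds (by rw [← h]; norm_num))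
    refine (contDiffAt_const (c := (1:ℝ))).congr_of_eventuallyEq ?_
    filter_upwards [this] with w hw using hlow _ ⟨hq0 w, hw.le⟩

lemma min_of_deriv {h κ : ℝ → ℝ} {a b xs x : ℝ} (hd : ∀ t, HasDerivAt h (κ t * (t - xs)) t)
    (hκ : ∀ t ∈ Icc a b, 0 ≤ κ t) (hxs : xs ∈ Icc a b) (hx : x ∈ Icc a b) : h xs ≤ h x := by
  have hc : Continuous h := continuous_iff_continuousAt.2 fun t => (hd t).continuousAt
  rcases le_total xs x with hle | hle
  · have : MonotoneOn h (Icc xs x) := by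
      refine monotoneOn_of_deriv_nonneg (convex_Icc _ _) hc.continuousOn
        (fun t _ => (hd t).differentiableAt.differentiableWithinAt) ?_
      intro t ht
      rw [interior_Icc] at ht
      rw [(hd t).deriv]
      exact mul_nonneg (hκ t ⟨hxs.1.trans ht.1.le, ht.2.le.trans hx.2⟩) (by linarith [ht.1])
    exact this ⟨le_rfl, hle⟩ ⟨hle, le_rfl⟩ hle
  · have : AntitoneOn h (Icc x xs) := by
      refine antitoneOn_of_deriv_nonpos (convex_Icc _ _) hc.continuousOn
        (fun t _ => (hd t).differentiableAt.differentiableWithinAt) ?_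
      intro t ht
      rw [interior_Icc] at ht
      rw [(hd t).deriv]
      exact mul_nonpos_of_nonneg_of_nonpos
        (hκ t ⟨hx.1.trans ht.1.le, ht.2.le.trans hxs.2⟩) (by linarith [ht.2])
    exact this ⟨le_rfl, hle⟩ ⟨hle, le_rfl⟩ hle

lemma pl_one {g k : ℝ → ℝ} {γ m M a b xs x x' : ℝ} (hγ : 0 < γ) (hm : 0 < m)
    (hd : ∀ t, HasDerivAt g (k t * (γ * (t - xs))) t)
    (hk : ∀ t ∈ Icc a b, m ≤ k t ∧ k t ≤ M) (hxs : xs ∈ Icc a b) (hx : x ∈ Icc a b)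
    (hx' : x' ∈ Icc a b) :
    g x - g x' ≤ M / (2 * γ * m ^ 2) * (k x * (γ * (x - xs))) ^ 2 := by
  have h1 : g xs ≤ g x' := by
    refine min_of_deriv (κ := fun t => k t * γ) (a := a) (b := b) (fun t => ?_) ?_ hxs hx'
    · refine (hd t).congr_deriv (by ring)
    · intro t ht
      have := (hk t ht).1
      have : 0 ≤ k t := by linarith
      positivity
  have h2 : M * γ / 2 * (xs - xs) ^ 2 - g xs ≤ M * γ / 2 * (x - xs) ^ 2 - g x := by
    refine min_of_deriv (h := fun t => M * γ / 2 * (t - xs) ^ 2 - g t)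
      (κ := fun t => (M - k t) * γ) (a := a) (b := b) (fun t => ?_) ?_ hxs hx
    · have e := ((((hasDerivAt_id t).sub_const xs).pow 2).const_mul (M * γ / 2)).sub (hd t)
      refine e.congr_deriv ?_
      simp
      ring
    · intro t ht
      have := (hk t ht).2
      have : 0 ≤ M - k t := by linarith
      positivity
  have hkx := hk x hx
  have hM : 0 ≤ M := by linarith
  have h3 : M * γ / 2 * (x - xs) ^ 2 ≤ M / (2 * γ * m ^ 2) * (k x * (γ * (x - xs))) ^ 2 := by
    have e1 : m ^ 2 ≤ k x ^ 2 := pow_le_pow_left₀ hm.le hkx.1 2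
    have e2 : M * γ / 2 * (x - xs) ^ 2 =
      M / (2 * γ * m ^ 2) * (m ^ 2 * (γ * (x - xs)) ^ 2) := by field_simp
    rw [e2, mul_pow (k x)]
    apply mul_le_mul_of_nonneg_left _ (by positivity)
    exact mul_le_mul_of_nonneg_right e1 (by positivity)
  simp at h2
  linarith

lemma final_mu {γ r0 : ℝ} (hγ : 0 < γ) (hr0 : 0 < r0) {φ1 φ2 : ℝ × ℝ → ℝ}
    (h1 : ContDiff ℝ (⊤ : ℕ∞) φ1) (h2 : ContDiff ℝ (⊤ : ℕ∞) φ2)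
    (p1 : ∀ p, 0 < φ1 p) (p2 : ∀ p, 0 < φ2 p)
    (hlow : ∀ p : ℝ × ℝ, p.1 ^ 2 + p.2 ^ 2 ≤ r0 ^ 2 → φ1 p = 1 ∧ φ2 p = 1)
    (s1 : ∀ x y, φ1 (-y, x) = φ2 (x, y)) (s2 : ∀ x y, φ2 (-y, x) = φ1 (x, y)) :
    ∃ (f μ : ℝ × ℝ → ℝ) (r : ℝ), 0 < r ∧ ContDiff ℝ (⊤ : ℕ∞) f ∧ Continuous μ ∧ (∀ z, 0 < μ z) ∧
      (∀ z : ℝ × ℝ, HasFDerivAt f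
          ((μ z * ((z.2 + γ * z.1) * φ2 z)) • ContinuousLinearMap.fst ℝ ℝ ℝ +
            (-(μ z * ((γ * z.2 - z.1) * φ1 z))) • ContinuousLinearMap.snd ℝ ℝ ℝ) z) ∧
      (∀ z : ℝ × ℝ, z.1 ^ 2 + z.2 ^ 2 < r ^ 2 →
        f z = γ / 2 * z.1 ^ 2 + z.1 * z.2 - γ / 2 * z.2 ^ 2) := by
  obtain ⟨f, r, hr, H1, H2⟩ := glue hγ hr0 h1 h2 p1 p2 hlow s1 s2
  have hsq : Continuous fun z : ℝ × ℝ => z.1 ^ 2 + z.2 ^ 2 := by fun_prop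
  have ev : ∀ z : ℝ × ℝ, z.1 ^ 2 + z.2 ^ 2 < r ^ 2 →
      f =ᶠ[𝓝 z] fun z => γ / 2 * z.1 ^ 2 + z.1 * z.2 - γ / 2 * z.2 ^ 2 := by
    intro z hz
    filter_upwards [hsq.continuousAt.eventually (gt_mem_nhds hz)] with w hw using H2 w hw
  have hd0 : ∀ z : ℝ × ℝ, z.1 ^ 2 + z.2 ^ 2 < r ^ 2 →
      HasFDerivAt f ((z.2 + γ * z.1) • ContinuousLinearMap.fst ℝ ℝ ℝ +
        (-(γ * z.2 - z.1)) • ContinuousLinearMap.snd ℝ ℝ ℝ) z := by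
    intro z hz
    refine HasFDerivAt.congr_of_eventuallyEq ?_ (ev z hz)
    have a := hasFDerivAt_fst (𝕜 := ℝ) (p := z)
    have b := hasFDerivAt_snd (𝕜 := ℝ) (p := z)
    have := (((a.pow 2).const_mul (γ / 2)).add (a.mul b)).sub ((b.pow 2).const_mul (γ / 2))
    refine this.congr_fderiv ?_
    apply ContinuousLinearMap.ext
    intro q
    simp
    ring
  have hC : ContDiff ℝ (⊤ : ℕ∞) f := by
    rw [contDiff_iff_contDiffAt]
    intro z
    by_cases hz : z = 0
    · subst hz
      refine ContDiffAt.congr_of_eventuallyEq ?_ (ev 0 (by simp; positivity))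
      exact (((contDiff_const.mul (contDiff_fst.pow 2)).add (contDiff_fst.mul contDiff_snd)).sub
        (contDiff_const.mul (contDiff_snd.pow 2))).contDiffAt
    · exact (H1 z hz).1
  classical
  choose! ν hν hνd using fun z hz => (H1 z hz).2
  set μ : ℝ × ℝ → ℝ := fun z => if z = 0 then 1 else ν z with hμ
  have hvpos : ∀ z : ℝ × ℝ, z ≠ 0 →
      0 < ((γ * z.2 - z.1) * φ1 z) ^ 2 + ((z.2 + γ * z.1) * φ2 z) ^ 2 := by
    intro z hz
    have q1 := p1 z
    have q2 := p2 z
    by_contra hcon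
    have e1 : ((γ * z.2 - z.1) * φ1 z) ^ 2 = 0 := by
      nlinarith [sq_nonneg ((γ * z.2 - z.1) * φ1 z), sq_nonneg ((z.2 + γ * z.1) * φ2 z)]
    have e2 : ((z.2 + γ * z.1) * φ2 z) ^ 2 = 0 := by
      nlinarith [sq_nonneg ((γ * z.2 - z.1) * φ1 z), sq_nonneg ((z.2 + γ * z.1) * φ2 z)]
    have e3 : γ * z.2 - z.1 = 0 := by
      rcases mul_eq_zero.1 (pow_eq_zero_iff (two_ne_zero)|>.1 e1) with h | h
      · exact h
      · exact absurd h q1.ne'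
    have e4 : z.2 + γ * z.1 = 0 := by
      rcases mul_eq_zero.1 (pow_eq_zero_iff (two_ne_zero)|>.1 e2) with h | h
      · exact h
      · exact absurd h q2.ne'
    apply hz
    have h3 : z.1 = γ * z.2 := by linarith
    have h4 : z.2 * (1 + γ ^ 2) = 0 := by rw [h3] at e4; linarith
    have h5 : z.2 = 0 := by
      rcases mul_eq_zero.1 h4 with h | h
      · exact h
      · nlinarith [sq_nonneg γ]
    exact Prod.ext (by simp [h3, h5]) (by simp [h5])
  have hμd : ∀ z : ℝ × ℝ, HasFDerivAt f
          ((μ z * ((z.2 + γ * z.1) * φ2 z)) • ContinuousLinearMap.fst ℝ ℝ ℝ +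
            (-(μ z * ((γ * z.2 - z.1) * φ1 z))) • ContinuousLinearMap.snd ℝ ℝ ℝ) z := by
    intro z
    by_cases hz : z = 0
    · subst hz
      have := hd0 0 (by simp; positivity)
      simpa using this
    · simp only [hμ, if_neg hz]
      exact hνd z hz
  have hμe : ∀ z : ℝ × ℝ, z ≠ 0 → μ z = (fderiv ℝ f z (1, 0) * ((z.2 + γ * z.1) * φ2 z) -
      fderiv ℝ f z (0, 1) * ((γ * z.2 - z.1) * φ1 z)) /
      (((γ * z.2 - z.1) * φ1 z) ^ 2 + ((z.2 + γ * z.1) * φ2 z) ^ 2) := by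
    intro z hz
    rw [eq_div_iff (hvpos z hz).ne', (hμd z).fderiv]
    simp
    ring
  refine ⟨f, μ, r, hr, hC, ?_, ?_, hμd, H2⟩
  · rw [continuous_iff_continuousAt]
    intro z
    by_cases hz : z = 0
    · subst hz
      refine (continuousAt_const (y := (1:ℝ))).congr ?_
      filter_upwards [hsq.continuousAt.eventually
        (gt_mem_nhds (show (0:ℝ × ℝ).1 ^ 2 + (0:ℝ × ℝ).2 ^ 2 < r ^ 2 by simp; positivity)),
        hsq.continuousAt.eventually
        (gt_mem_nhds (show (0:ℝ × ℝ).1 ^ 2 + (0:ℝ × ℝ).2 ^ 2 < r0 ^ 2 by simp; positivity))]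
        with w w1 w2
      by_cases hw : w = 0
      · simp [hμ, hw]
      · rw [hμe w hw, (hd0 w w1).fderiv, eq_div_iff (hvpos w hw).ne', (hlow w w2.le).1,
          (hlow w w2.le).2]
        simp
        ring
    · have c1 : Continuous fun z => fderiv ℝ f z :=
        hC.continuous_fderiv (by simp)
      have c2 := h1.continuous
      have c3 := h2.continuous
      have cc : ContinuousAt (fun z : ℝ × ℝ =>
        (fderiv ℝ f z (1, 0) * ((z.2 + γ * z.1) * φ2 z) -
          fderiv ℝ f z (0, 1) * ((γ * z.2 - z.1) * φ1 z)) /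
          (((γ * z.2 - z.1) * φ1 z) ^ 2 + ((z.2 + γ * z.1) * φ2 z) ^ 2)) z := by
        refine ContinuousAt.div ?_ ?_ (hvpos z hz).ne'
        · exact Continuous.continuousAt (by fun_prop)
        · exact Continuous.continuousAt (by fun_prop)
      refine cc.congr ?_
      filter_upwards [isOpen_ne.mem_nhds hz] with w hw using (hμe w hw).symm
  · intro z
    by_cases hz : z = 0
    · simp [hμ, hz]
    · simp only [hμ, if_neg hz]
      exact hν z hz

/-- There exist a `C^∞` function `f : ℝ² → ℝ` and a radius `r > 0` such that:
(i) `f(x,y) = (γ/2)x² + xy - (γ/2)y²` on the open Euclidean ball `B_r`;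
(ii) `∇f` is orthogonal to `v` everywhere;
(iii) the origin is the unique critical point of `f`;
(iv) for every `R < ∞`, `f` satisfies the two-sided PL condition on `[-R,R]²` with some
constant `C < ∞`. -/
theorem statement_18 (γ : ℝ) (hγ : γ ^ 3 + γ ^ 2 + γ - 1 / 3 = 0)
    (φ : ℝ → ℝ) (hφsmooth : ContDiffOn ℝ (⊤ : ℕ∞) φ (Ici 0))
    (hφmono : MonotoneOn φ (Ici 0))
    (hφone : ∀ t ∈ Ici (0 : ℝ), 1 ≤ φ t)
    (hφlow : ∀ t ∈ Icc (0 : ℝ) (1 / 2), φ t = 1)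
    (hφhigh : ∀ t ∈ Ici (1 : ℝ), φ t = 2 * t) :
    ∃ (f : ℝ × ℝ → ℝ) (r : ℝ), 0 < r ∧
      ContDiff ℝ (⊤ : ℕ∞) f ∧
      (∀ p : ℝ × ℝ, p.1 ^ 2 + p.2 ^ 2 < r ^ 2 →
        f p = γ / 2 * p.1 ^ 2 + p.1 * p.2 - γ / 2 * p.2 ^ 2) ∧
      (∀ z : ℝ × ℝ,
        pdx f z * (vf γ φ z).1 + pdy f z * (vf γ φ z).2 = 0) ∧
      (pdx f (0, 0) = 0 ∧ pdy f (0, 0) = 0) ∧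
      (∀ z : ℝ × ℝ, z ≠ (0, 0) → ¬(pdx f z = 0 ∧ pdy f z = 0)) ∧
      (∀ R : ℝ, ∃ C : ℝ, ∀ x ∈ Icc (-R) R, ∀ y ∈ Icc (-R) R,
        f (x, y) - sInf ((fun x' => f (x', y)) '' Icc (-R) R) ≤
          C * (pdx f (x, y)) ^ 2 ∧
        sSup ((fun y' => f (x, y')) '' Icc (-R) R) - f (x, y) ≤
          C * (pdy f (x, y)) ^ 2) := by
  have hγ0 : 0 < γ := by
    by_contra h
    push Not at h
    nlinarith [sq_nonneg γ, sq_nonneg (γ + 1), mul_nonneg (neg_nonneg.2 h) (sq_nonneg (γ + 1))]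
  set q1 : ℝ × ℝ → ℝ :=
    fun p => p.1 ^ 2 + (γ + 1) * p.1 * p.2 + (γ ^ 2 + γ + 1) * p.2 ^ 2 with hq1
  set q2 : ℝ × ℝ → ℝ :=
    fun p => p.2 ^ 2 - (γ + 1) * p.1 * p.2 + (γ ^ 2 + γ + 1) * p.1 ^ 2 with hq2
  have hq1C : ContDiff ℝ (⊤ : ℕ∞) q1 :=
    ((contDiff_fst.pow 2).add ((contDiff_const.mul contDiff_fst).mul contDiff_snd)).add
      (contDiff_const.mul (contDiff_snd.pow 2))
  have hq2C : ContDiff ℝ (⊤ : ℕ∞) q2 :=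
    ((contDiff_snd.pow 2).sub ((contDiff_const.mul contDiff_fst).mul contDiff_snd)).add
      (contDiff_const.mul (contDiff_fst.pow 2))
  have hq10 : ∀ p, 0 ≤ q1 p := by
    intro p
    have : q1 p = (p.1 + (γ + 1) / 2 * p.2) ^ 2 +
      (3 * γ ^ 2 + 2 * γ + 3) / 4 * p.2 ^ 2 := by simp only [hq1]; ring
    rw [this]; positivity
  have hq20 : ∀ p, 0 ≤ q2 p := by
    intro p
    have : q2 p = (p.2 - (γ + 1) / 2 * p.1) ^ 2 +
      (3 * γ ^ 2 + 2 * γ + 3) / 4 * p.1 ^ 2 := by simp only [hq2]; ring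
    rw [this]; positivity
  set N : ℝ := 2 * (γ ^ 2 + 2 * γ + 2) with hN
  have hN0 : 0 < N := by positivity
  set r0 : ℝ := 1 / N with hr0
  have hr0p : 0 < r0 := by positivity
  have hN1 : 1 ≤ N := by nlinarith [sq_nonneg γ]
  have hr0N : N * r0 ^ 2 ≤ 1 := by
    have : N * r0 ^ 2 = 1 / N := by rw [hr0]; field_simp
    rw [this, div_le_one hN0]; exact hN1
  have hlow : ∀ p : ℝ × ℝ, p.1 ^ 2 + p.2 ^ 2 ≤ r0 ^ 2 → φ (q1 p) = 1 ∧ φ (q2 p) = 1 := by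
    intro p hp
    have e0 : N * (p.1 ^ 2 + p.2 ^ 2) ≤ 1 := (mul_le_mul_of_nonneg_left hp hN0.le).trans hr0N
    have e1 : (γ + 1) * (p.1 * p.2) ≤ (γ + 1) * ((p.1 ^ 2 + p.2 ^ 2) / 2) :=
      mul_le_mul_of_nonneg_left (by nlinarith [sq_nonneg (p.1 - p.2)]) (by positivity)
    have e2 : -((γ + 1) * (p.1 * p.2)) ≤ (γ + 1) * ((p.1 ^ 2 + p.2 ^ 2) / 2) := by
      rw [← mul_neg]
      exact mul_le_mul_of_nonneg_left (by nlinarith [sq_nonneg (p.1 + p.2)]) (by positivity)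
    have e3 : 0 ≤ γ * p.1 ^ 2 := by positivity
    have e4 : 0 ≤ γ * p.2 ^ 2 := by positivity
    have e5 : 0 ≤ γ ^ 2 * p.1 ^ 2 := by positivity
    have e6 : 0 ≤ γ ^ 2 * p.2 ^ 2 := by positivity
    have e7 := sq_nonneg p.1
    have e8 := sq_nonneg p.2
    rw [hN] at e0
    refine ⟨hφlow _ ⟨hq10 p, ?_⟩, hφlow _ ⟨hq20 p, ?_⟩⟩
    · simp only [hq1]
      linarith
    · simp only [hq2]
      linarith
  have hs1 : ∀ x y, φ (q1 (-y, x)) = φ (q2 (x, y)) := by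
    intro x y
    congr 1
    simp only [hq1, hq2]; ring
  have hs2 : ∀ x y, φ (q2 (-y, x)) = φ (q1 (x, y)) := by
    intro x y
    congr 1
    simp only [hq1, hq2]; ring
  have hp1 : ∀ p, 0 < φ (q1 p) := fun p => lt_of_lt_of_le one_pos (hφone _ (hq10 p))
  have hp2 : ∀ p, 0 < φ (q2 p) := fun p => lt_of_lt_of_le one_pos (hφone _ (hq20 p))
  have hC1 := phi_comp hφsmooth hφlow hq1C hq10
  have hC2 := phi_comp hφsmooth hφlow hq2C hq20
  obtain ⟨f, μ, r, hr, hfC, hμc, hμp, hfd, hfr⟩ := final_mu hγ0 hr0p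
    (φ1 := fun p => φ (q1 p)) (φ2 := fun p => φ (q2 p)) hC1 hC2 hp1 hp2 hlow hs1 hs2
  have hdx : ∀ x y : ℝ, HasDerivAt (fun t => f (t, y))
      (μ (x, y) * ((y + γ * x) * φ (q2 (x, y)))) x := by
    intro x y
    have e1 : HasDerivAt (fun t => (t, y)) ((1:ℝ), (0:ℝ)) x :=
      (hasDerivAt_id x).prodMk (hasDerivAt_const _ _)
    have e2 := HasFDerivAt.comp_hasDerivAt (l := f) x (hfd (x, y)) e1
    refine e2.congr_deriv ?_
    simp
  have hdy : ∀ x y : ℝ, HasDerivAt (fun t => f (x, t))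
      (-(μ (x, y) * ((γ * y - x) * φ (q1 (x, y))))) y := by
    intro x y
    have e1 : HasDerivAt (fun t => (x, t)) ((0:ℝ), (1:ℝ)) y :=
      (hasDerivAt_const _ _).prodMk (hasDerivAt_id y)
    have e2 := HasFDerivAt.comp_hasDerivAt (l := f) y (hfd (x, y)) e1
    refine e2.congr_deriv ?_
    simp
  have hpx : ∀ z : ℝ × ℝ, pdx f z = μ z * ((z.2 + γ * z.1) * φ (q2 z)) :=
    fun z => (hdx z.1 z.2).deriv
  have hpy : ∀ z : ℝ × ℝ, pdy f z = -(μ z * ((γ * z.2 - z.1) * φ (q1 z))) :=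
    fun z => (hdy z.1 z.2).deriv
  refine ⟨f, r, hr, hfC, hfr, ?_, ?_, ?_, ?_⟩
  · intro z
    have e : vf γ φ z = ((γ * z.2 - z.1) * φ (q1 z), (z.2 + γ * z.1) * φ (q2 z)) := rfl
    rw [hpx, hpy, e]
    ring
  · rw [hpx, hpy]
    simp
  · rintro z hz ⟨e1, e2⟩
    rw [hpx] at e1
    rw [hpy, neg_eq_zero] at e2
    have e3 : z.2 + γ * z.1 = 0 := by
      have a := (hμp z).ne'
      have b := (hp2 z).ne'
      simpa [a, b] using e1
    have e4 : γ * z.2 - z.1 = 0 := by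
      have a := (hμp z).ne'
      have b := (hp1 z).ne'
      simpa [a, b] using e2
    apply hz
    have h3 : z.1 = γ * z.2 := by linarith
    have h4 : z.2 * (1 + γ ^ 2) = 0 := by rw [h3] at e3; linarith
    have h5 : z.2 = 0 := by
      rcases mul_eq_zero.1 h4 with h | h
      · exact h
      · nlinarith [sq_nonneg γ]
    exact Prod.ext (by simp [h3, h5]) (by simp [h5])
  · intro R
    set R' : ℝ := |R| + |R| / γ with hR'
    have hRγ : 0 ≤ |R| / γ := by positivity
    have hR0 := abs_nonneg R
    set B : Set (ℝ × ℝ) := Icc (-R') R' ×ˢ Icc (-R') R' with hB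
    have hBc : IsCompact B := isCompact_Icc.prod isCompact_Icc
    have hBne : B.Nonempty := ⟨(0, 0), ⟨⟨by simp only; linarith, by simp only; linarith⟩,
      ⟨by simp only; linarith, by simp only; linarith⟩⟩⟩
    have bnd : ∀ k : ℝ × ℝ → ℝ, Continuous k → (∀ z, 0 < k z) →
        ∃ m M, 0 < m ∧ ∀ z ∈ B, m ≤ k z ∧ k z ≤ M := by
      intro k hk hkp
      obtain ⟨a, -, ha⟩ := hBc.exists_isMinOn hBne hk.continuousOn
      obtain ⟨b, -, hb⟩ := hBc.exists_isMaxOn hBne hk.continuousOn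
      exact ⟨k a, k b, hkp a, fun z hz => ⟨ha hz, hb hz⟩⟩
    obtain ⟨m1, M1, hm1, hk1⟩ := bnd (fun z => μ z * φ (q1 z))
      (hμc.mul hC1.continuous) (fun z => mul_pos (hμp z) (hp1 z))
    obtain ⟨m2, M2, hm2, hk2⟩ := bnd (fun z => μ z * φ (q2 z))
      (hμc.mul hC2.continuous) (fun z => mul_pos (hμp z) (hp2 z))
    have hin : ∀ t ∈ Icc (-R) R, t ∈ Icc (-R') R' := by
      intro t ht
      have := le_abs_self R
      exact ⟨by linarith [ht.1], by linarith [ht.2]⟩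
    have hdiv : ∀ t ∈ Icc (-R) R, t / γ ∈ Icc (-R') R' ∧ -t / γ ∈ Icc (-R') R' := by
      intro t ht
      have h1 : |t| ≤ |R| := (abs_le.2 ht).trans (le_abs_self R)
      have h2 : |t / γ| ≤ |R| / γ := by
        rw [abs_div, abs_of_pos hγ0]
        exact div_le_div_of_nonneg_right h1 hγ0.le
      have h3 := abs_le.1 h2
      have h4 : -t / γ = -(t / γ) := by ring
      rw [h4]
      exact ⟨⟨by linarith [h3.1], by linarith [h3.2]⟩, ⟨by linarith [h3.2], by linarith [h3.1]⟩⟩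
    refine ⟨max (M2 / (2 * γ * m2 ^ 2)) (M1 / (2 * γ * m1 ^ 2)), ?_⟩
    intro x hx y hy
    constructor
    · have key : ∀ x' ∈ Icc (-R) R, f (x, y) - f (x', y) ≤
          M2 / (2 * γ * m2 ^ 2) * (pdx f (x, y)) ^ 2 := by
        intro x' hx'
        have := pl_one (g := fun t => f (t, y)) (k := fun t => μ (t, y) * φ (q2 (t, y)))
          (xs := -y / γ) (m := m2) (M := M2) (a := -R') (b := R') (x := x) (x' := x') hγ0 hm2
          (fun t => (hdx t y).congr_deriv (by field_simp; ring))
          (fun t ht => hk2 (t, y) ⟨ht, hin y hy⟩) (hdiv y hy).2 (hin x hx) (hin x' hx')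
        refine this.trans (le_of_eq ?_)
        rw [hpx]
        congr 2
        simp only
        field_simp
        ring
      have h1 : f (x, y) - M2 / (2 * γ * m2 ^ 2) * (pdx f (x, y)) ^ 2 ≤
          sInf ((fun x' => f (x', y)) '' Icc (-R) R) := by
        refine le_csInf ⟨_, mem_image_of_mem _ hx⟩ ?_
        rintro _ ⟨x', hx', rfl⟩
        have := key x' hx'
        simp only
        linarith
      have h2 := mul_le_mul_of_nonneg_right
        (le_max_left (M2 / (2 * γ * m2 ^ 2)) (M1 / (2 * γ * m1 ^ 2))) (sq_nonneg (pdx f (x, y)))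
      linarith
    · have key : ∀ y' ∈ Icc (-R) R, f (x, y') - f (x, y) ≤
          M1 / (2 * γ * m1 ^ 2) * (pdy f (x, y)) ^ 2 := by
        intro y' hy'
        have := pl_one (g := fun t => - f (x, t)) (k := fun t => μ (x, t) * φ (q1 (x, t)))
          (xs := x / γ) (m := m1) (M := M1) (a := -R') (b := R') (x := y) (x' := y') hγ0 hm1
          (fun t => (hdy x t).neg.congr_deriv (by field_simp))
          (fun t ht => hk1 (x, t) ⟨hin x hx, ht⟩) (hdiv x hx).1 (hin y hy) (hin y' hy')
        have e : f (x, y') - f (x, y) = - f (x, y) - - f (x, y') := by ring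
        rw [e]
        refine this.trans (le_of_eq ?_)
        rw [hpy, neg_sq]
        congr 2
        simp only
        field_simp
      have h1 : sSup ((fun y' => f (x, y')) '' Icc (-R) R) ≤
          f (x, y) + M1 / (2 * γ * m1 ^ 2) * (pdy f (x, y)) ^ 2 := by
        refine csSup_le ⟨_, mem_image_of_mem _ hy⟩ ?_
        rintro _ ⟨y', hy', rfl⟩
        have := key y' hy'
        simp only
        linarith
      have h2 := mul_le_mul_of_nonneg_right
        (le_max_right (M2 / (2 * γ * m2 ^ 2)) (M1 / (2 * γ * m1 ^ 2))) (sq_nonneg (pdy f (x, y)))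
      linarith
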